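/- arXiv:2407.20374 — 2 statements merged into one kernel-verified Lean document; each statement's English description precedes it below -/
import Mathlib

section
/- Suppose n is not a power of 2, and write n' = n/2 if n is even and n' = n if n is odd. Then the image of Δ under reduction mod 2O is a subgroup of SL₂(O/2O) isomorphic to the dihedral group of order 2n'. -/
open Matrix
open scoped MatrixGroups

set_option synthInstance.maxHeartbeats 1000000
set_option maxHeartbeats 1000000

noncomputable section

/-- The ring `O = ℤ[ζ + ζ⁻¹]`, realized as a subalgebra of `ℂ`. -/
abbrev Oring (ζ : ℂ) : Subalgebra ℤ ℂ := Algebra.adjoin ℤ {ζ + ζ⁻¹}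

/-- The element `ζ + ζ⁻¹` of `O`. -/
def lamO (ζ : ℂ) : Oring ζ := ⟨ζ + ζ⁻¹, Algebra.subset_adjoin rfl⟩

/-- The matrix `T = [[1, 2 + ζ + ζ⁻¹], [0, 1]]` in `SL₂(O)`. -/
def Tmat (ζ : ℂ) : SL(2, Oring ζ) :=
  ⟨!![1, 2 + lamO ζ; 0, 1], by rw [Matrix.det_fin_two_of]; ring⟩

/-- The matrix `U = [[-1, 0], [1, -1]]` in `SL₂(O)`. -/
def Umat (ζ : ℂ) : SL(2, Oring ζ) :=
  ⟨!![-1, 0; 1, -1], by rw [Matrix.det_fin_two_of]; ring⟩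

/-- The matrix `R = U * T` in `SL₂(O)`. -/
def Rmat (ζ : ℂ) : SL(2, Oring ζ) := Umat ζ * Tmat ζ

/-- The triangle group `Δ = ⟨T, U⟩ ⊆ SL₂(O)`. -/
def Delta (ζ : ℂ) : Subgroup SL(2, Oring ζ) := Subgroup.closure {Tmat ζ, Umat ζ}

/-- Reduction mod the ideal `J`: the natural map `SL₂(O) → SL₂(O/J)`. -/
def SLred (ζ : ℂ) (J : Ideal (Oring ζ)) : SL(2, Oring ζ) →* SL(2, Oring ζ ⧸ J) :=
  Matrix.SpecialLinearGroup.map (Ideal.Quotient.mk J)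


/-- `n' = n/2` if `n` is even, and `n' = n` if `n` is odd. -/
def nprime (n : ℕ) : ℕ := if Even n then n / 2 else n


theorem dih_aux {G : Type*} [Group G] (a b : G) (m : ℕ) (ha : a * a = 1) (hb : b * b = 1)
    (hm : 3 ≤ m) (ho : orderOf (b * a) = m) :
    Nonempty (↥(Subgroup.closure {a, b}) ≃* DihedralGroup m) := by
  set ρ := b * a with hρ
  have hai : a⁻¹ = a := inv_eq_of_mul_eq_one_left ha
  have hbi : b⁻¹ = b := inv_eq_of_mul_eq_one_left hb
  have hconj : ∀ k : ℤ, ρ ^ k * a = a * ρ ^ (-k) := by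
    intro k
    have h1 : a⁻¹ * ρ * a⁻¹⁻¹ = ρ⁻¹ := by
      rw [hρ, _root_.mul_inv_rev, inv_inv, hai, hbi]
      simp only [mul_assoc, ha, mul_one]
    have h2 : a⁻¹ * ρ ^ k * a⁻¹⁻¹ = ρ ^ (-k) := by
      rw [← conj_zpow, h1, _root_.inv_zpow, _root_.zpow_neg]
    rw [inv_inv] at h2
    rw [← h2]; group
  let g : ZMod m →+ Additive G := ZMod.lift m ⟨zmultiplesHom (Additive G) (Additive.ofMul ρ), by
    have : ρ ^ m = 1 := by rw [← ho]; exact pow_orderOf_eq_one ρ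
    simp only [zmultiplesHom_apply]
    rw [← ofMul_zpow, zpow_natCast, this]; rfl⟩
  let e : ZMod m → G := fun i => (g i).toMul
  have e_int : ∀ k : ℤ, e (k : ZMod m) = ρ ^ k := by
    intro k
    simp only [e, g, ZMod.lift_coe, zmultiplesHom_apply]
    rfl
  have e_add : ∀ i j, e (i + j) = e i * e j := by
    intro i j; simp only [e, map_add]; rfl
  have e_a : ∀ i, e i * a = a * e (-i) := by
    intro i
    obtain ⟨k, rfl⟩ := ZMod.intCast_surjective i
    rw [← Int.cast_neg, e_int, e_int, hconj]
  have e_zero : ∀ i, e i = 1 → i = 0 := by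
    intro i hi
    obtain ⟨k, rfl⟩ := ZMod.intCast_surjective i
    rw [e_int, ← orderOf_dvd_iff_zpow_eq_one, ho] at hi
    exact (ZMod.intCast_zmod_eq_zero_iff_dvd k m).2 hi
  let f : DihedralGroup m →* G := MonoidHom.mk' (fun x => match x with
    | .r i => e i
    | .sr i => a * e i) (by
      rintro (i | i) (j | j)
      · exact e_add i j
      · change a * e (j - i) = e i * (a * e j)
        rw [← mul_assoc, e_a, mul_assoc, ← e_add]; congr 2; ring
      · change a * e (i + j) = a * e i * e j
        rw [e_add, mul_assoc]
      · change e (j - i) = a * e i * (a * e j)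
        rw [mul_assoc a, ← mul_assoc (e i), e_a, mul_assoc a, ← e_add, ← mul_assoc, ha, one_mul]
        congr 1; ring)
  have fr : ∀ i, f (.r i) = e i := fun _ => rfl
  have fsr : ∀ i, f (.sr i) = a * e i := fun _ => rfl
  have e0 : e 0 = 1 := by have := e_int 0; simpa using this
  have finj : Function.Injective f := by
    rw [injective_iff_map_eq_one]
    rintro (i | i) h
    · rw [fr] at h
      rw [e_zero i h]; rfl
    · exfalso
      rw [fsr] at h
      obtain ⟨k, rfl⟩ := ZMod.intCast_surjective i
      rw [e_int] at h
      have h1 : a = ρ ^ (-k) := by rw [_root_.zpow_neg]; exact eq_inv_of_mul_eq_one_left h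
      have h2 := hconj 1
      have h3 : ρ ^ (1 : ℤ) * a = a * ρ ^ (1 : ℤ) := by rw [h1, ← _root_.zpow_add, ← _root_.zpow_add, add_comm]
      rw [h3] at h2
      have h4 := mul_left_cancel h2
      have h5 : ρ ^ 2 = 1 := by
        rw [_root_.zpow_neg, zpow_one] at h4
        rw [pow_two]; nth_rewrite 1 [h4]; simp
      have h6 := orderOf_dvd_of_pow_eq_one h5
      rw [ho] at h6
      have := Nat.le_of_dvd (by norm_num) h6
      omega
  have frange : f.range = Subgroup.closure {a, b} := by
    apply le_antisymm
    · have haM : a ∈ Subgroup.closure {a, b} := Subgroup.subset_closure (by simp)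
      have hbM : b ∈ Subgroup.closure {a, b} := Subgroup.subset_closure (by simp)
      have he : ∀ i, e i ∈ Subgroup.closure {a, b} := by
        intro i
        obtain ⟨k, rfl⟩ := ZMod.intCast_surjective i
        rw [e_int]
        exact Subgroup.zpow_mem _ (Subgroup.mul_mem _ hbM haM) k
      rintro _ ⟨i | i, rfl⟩
      · exact he i
      · exact Subgroup.mul_mem _ haM (he i)
    · rw [Subgroup.closure_le]
      rintro x (rfl | rfl)
      · exact ⟨.sr 0, by rw [fsr, e0, mul_one]⟩
      · refine ⟨.sr ((-1 : ℤ) : ZMod m), ?_⟩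
        rw [fsr, e_int, ← hconj, zpow_one, hρ, mul_assoc, ha, mul_one]
  exact ⟨((MonoidHom.ofInjective finj).trans (MulEquiv.subgroupCongr frange)).symm⟩

theorem half_not_integral (q : ℤ) (hq : ¬ (2 ∣ q)) (x : ℂ) (hx : IsIntegral ℤ x)
    (h : (q : ℂ) = 2 * x) : False := by
  have h1 : x = algebraMap ℚ ℂ ((q : ℚ) / 2) := by
    simp only [map_div₀, map_intCast, map_ofNat]; rw [h]; ring
  rw [h1, isIntegral_algebraMap_iff (algebraMap ℚ ℂ).injective,
    IsIntegrallyClosed.isIntegral_iff] at hx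
  obtain ⟨y, hy⟩ := hx
  apply hq
  refine ⟨y, ?_⟩
  have : (q : ℚ) = 2 * y := by
    have : (y : ℚ) = q / 2 := by simpa using hy
    rw [this]; ring
  exact_mod_cast this

theorem pow_cong (ξ α : ℂ) (hα : IsIntegral ℤ α) (h : ξ = 1 + 2 * α) (k : ℕ) :
    ∃ β : ℂ, IsIntegral ℤ β ∧ ξ ^ k = 1 + 2 * β := by
  induction k with
  | zero => exact ⟨0, isIntegral_zero, by simp⟩
  | succ k ih =>
    obtain ⟨β, hβ, h1⟩ := ih
    refine ⟨β + α + 2 * (β * α), ?_, by rw [pow_succ, h1, h]; ring⟩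
    have h2 : IsIntegral ℤ (2 : ℂ) := by simpa using isIntegral_algebraMap (R := ℤ) (A := ℂ) (x := 2)
    exact (hβ.add hα).add (h2.mul (hβ.mul hα))

theorem even_order (ξ α : ℂ) (hα : IsIntegral ℤ α) (h : ξ = 1 + 2 * α) (d : ℕ)
    (hd : IsPrimitiveRoot ξ d) (h1 : 1 < d) : 2 ∣ d := by
  by_contra hnd
  choose β hβ hb using pow_cong ξ α hα h
  have h2 := hd.geom_sum_eq_zero h1
  simp only [hb, Finset.sum_add_distrib, ← Finset.mul_sum] at h2
  refine half_not_integral d (by exact_mod_cast hnd) (-∑ i ∈ Finset.range d, β i)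
    (IsIntegral.neg (IsIntegral.sum _ fun i _ => hβ i)) ?_
  simp at h2
  push_cast
  linear_combination h2

theorem sq_one (ξ α : ℂ) (hα : IsIntegral ℤ α) (h : ξ = 1 + 2 * α) (N : ℕ) (hN : 0 < N)
    (hξ : ξ ^ N = 1) : ξ ^ 2 = 1 := by
  have hd := IsPrimitiveRoot.orderOf ξ
  set d := orderOf ξ with hdd
  have hdpos : 0 < d := orderOf_pos_iff.2 (isOfFinOrder_iff_pow_eq_one.2 ⟨N, hN, hξ⟩)
  by_contra hne
  have hnd : ¬ d ∣ 2 := fun hh => hne (orderOf_dvd_iff_pow_eq_one.1 hh)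
  have hd1 : 1 < d := by
    by_contra hc
    exact hnd ((show d = 1 by omega) ▸ one_dvd 2)
  obtain ⟨e, he⟩ := even_order ξ α hα h d hd hd1
  have hs : IsPrimitiveRoot (ξ ^ 2) e := hd.pow hdpos he
  have he1 : 1 < e := by
    by_contra hc
    have : e = 0 ∨ e = 1 := by omega
    rcases this with h0 | h0
    · omega
    · exact hnd (by rw [he, h0])
  obtain ⟨β, hβ, hb⟩ := pow_cong ξ α hα h 2
  obtain ⟨c, hc⟩ := even_order (ξ ^ 2) β hβ hb e hs he1
  obtain ⟨γ, hγ, hg⟩ := pow_cong ξ α hα h c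
  have h2 : IsPrimitiveRoot (ξ ^ (2 * c)) 2 := hd.pow hdpos (by rw [he, hc]; ring)
  have h3 : ξ ^ (2 * c) = -1 := h2.eq_neg_one_of_two_right
  rw [mul_comm, pow_mul, hg] at h3
  refine half_not_integral (-1) (by norm_num) (γ ^ 2 + γ) ((hγ.pow 2).add hγ) ?_
  push_cast
  linear_combination (-1/2 : ℂ) * h3

theorem coe_two (ζ : ℂ) : ((2 : Oring ζ) : ℂ) = 2 := rfl

theorem Rmat_val (ζ : ℂ) : (Rmat ζ).1 = !![-1, -(2 + lamO ζ); 1, 1 + lamO ζ] := by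
  have : (Rmat ζ).1 = (Umat ζ).1 * (Tmat ζ).1 := rfl
  rw [this, Tmat, Umat, Matrix.mul_fin_two]
  ext i j; fin_cases i <;> fin_cases j <;> simp [coe_two] <;> ring

/-- The complex matrix attached to a matrix over `O`. -/
def toC (ζ : ℂ) : Matrix (Fin 2) (Fin 2) (Oring ζ) →+* Matrix (Fin 2) (Fin 2) ℂ :=
  (Oring ζ).val.toRingHom.mapMatrix

theorem toC_apply (ζ : ℂ) (M : Matrix (Fin 2) (Fin 2) (Oring ζ)) (i j : Fin 2) :
    toC ζ M i j = (M i j : ℂ) := rfl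

theorem PR (ζ : ℂ) (h0 : ζ ≠ 0) :
    !![1, 1 + ζ; 1, 1 + ζ⁻¹] * toC ζ (Rmat ζ).1 =
      Matrix.diagonal ![ζ, ζ⁻¹] * !![1, 1 + ζ; 1, 1 + ζ⁻¹] := by
  rw [Rmat_val]
  ext i j
  fin_cases i <;> fin_cases j <;>
    simp [Matrix.mul_apply, Fin.sum_univ_two, toC_apply, lamO, coe_two] <;> field_simp <;> ring

theorem PRk (ζ : ℂ) (h0 : ζ ≠ 0) (k : ℕ) :
    !![1, 1 + ζ; 1, 1 + ζ⁻¹] * toC ζ ((Rmat ζ).1 ^ k) =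
      Matrix.diagonal ![ζ ^ k, ζ⁻¹ ^ k] * !![1, 1 + ζ; 1, 1 + ζ⁻¹] := by
  rw [map_pow]
  have h1 : ∀ k : ℕ, Matrix.diagonal ![ζ ^ k, ζ⁻¹ ^ k] = (Matrix.diagonal ![ζ, ζ⁻¹]) ^ k := by
    intro k
    rw [Matrix.diagonal_pow]
    congr 1; ext i; fin_cases i <;> simp
  rw [h1]
  induction k with
  | zero => simp
  | succ k ih => rw [pow_succ, ← mul_assoc, ih, mul_assoc, PR ζ h0, ← mul_assoc, ← pow_succ]

theorem SLred_eq_one (ζ : ℂ) (J : Ideal (Oring ζ)) (A : SL(2, Oring ζ)) :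
    SLred ζ J A = 1 ↔ ∀ i j, A.1 i j - (1 : Matrix (Fin 2) (Fin 2) (Oring ζ)) i j ∈ J := by
  rw [Matrix.SpecialLinearGroup.ext_iff]
  refine forall_congr' fun i => forall_congr' fun j => ?_
  rw [← Ideal.Quotient.eq]
  have h1 : (SLred ζ J A) i j = Ideal.Quotient.mk J (A.1 i j) := rfl
  have h2 : (1 : SL(2, Oring ζ ⧸ J)) i j =
      Ideal.Quotient.mk J ((1 : Matrix (Fin 2) (Fin 2) (Oring ζ)) i j) := by
    fin_cases i <;> fin_cases j <;> simp
  rw [h1, h2]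

theorem integral_O (ζ : ℂ) (n : ℕ) (hn : 0 < n) (hζ : IsPrimitiveRoot ζ n) (x : Oring ζ) :
    IsIntegral ℤ (x : ℂ) := by
  have h1 : IsIntegral ℤ (ζ + ζ⁻¹) := (hζ.isIntegral hn).add (hζ.inv.isIntegral hn)
  have : Oring ζ ≤ integralClosure ℤ ℂ := by
    apply Algebra.adjoin_le
    rintro _ rfl
    exact h1
  exact this x.2

theorem lower (ζ : ℂ) (n : ℕ) (hn : 3 ≤ n) (hζ : IsPrimitiveRoot ζ n) (k : ℕ)
    (h : SLred ζ (Ideal.span {(2 : Oring ζ)}) (Rmat ζ ^ k) = 1) : n ∣ 2 * k := by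
  have h0 : ζ ≠ 0 := hζ.ne_zero (by omega)
  rw [SLred_eq_one] at h
  have h00 := h 0 0
  have h10 := h 1 0
  rw [Ideal.mem_span_singleton'] at h00 h10
  obtain ⟨x, hx⟩ := h00
  obtain ⟨y, hy⟩ := h10
  have e := congrFun (congrFun (PRk ζ h0 k) 0) 0
  simp [Matrix.mul_apply, Fin.sum_univ_two, toC_apply, -map_pow] at e
  rw [Matrix.SpecialLinearGroup.coe_pow] at hx hy
  have hx' := congrArg (Subtype.val : Oring ζ → ℂ) hx
  have hy' := congrArg (Subtype.val : Oring ζ → ℂ) hy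
  simp [coe_two] at hx' hy'
  have hint := integral_O ζ n (by omega) hζ
  have hz : IsIntegral ℤ (1 + ζ) := isIntegral_one.add (hζ.isIntegral (by omega))
  have hs := sq_one (ζ ^ k) (x + (1 + ζ) * y) ((hint x).add (hz.mul (hint y)))
    (by linear_combination -e - hx' - (1 + ζ) * hy') n (by omega)
    (by rw [← pow_mul, mul_comm, pow_mul, hζ.pow_eq_one, one_pow])
  rw [← pow_mul] at hs
  rw [mul_comm]
  exact hζ.dvd_of_pow_eq_one _ hs

theorem upper (ζ : ℂ) (n : ℕ) (hn : 3 ≤ n) (hζ : IsPrimitiveRoot ζ n) (k : ℕ)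
    (hk : ζ ^ k = 1 ∨ ζ ^ k = -1) :
    SLred ζ (Ideal.span {(2 : Oring ζ)}) (Rmat ζ ^ k) = 1 := by
  have h0 : ζ ≠ 0 := hζ.ne_zero (by omega)
  obtain ⟨ε, hε, hz⟩ : ∃ ε : Oring ζ, (ε = 1 ∨ ε = -1) ∧ ζ ^ k = (ε : ℂ) := by
    rcases hk with h | h
    · exact ⟨1, Or.inl rfl, by simp [h]⟩
    · exact ⟨-1, Or.inr rfl, by simp [h]⟩
  have hzi : ζ⁻¹ ^ k = (ε : ℂ) := by
    rw [inv_pow, hz]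
    rcases hε with rfl | rfl <;> norm_num
  have hdiff : ζ⁻¹ - ζ ≠ 0 := by
    intro hc
    have : ζ ^ 2 = 1 := by field_simp at hc; linear_combination -hc
    have := Nat.le_of_dvd (by norm_num) (hζ.dvd_of_pow_eq_one _ this)
    omega
  have key := PRk ζ h0 k
  rw [hz, hzi] at key
  have hR : (Rmat ζ).1 ^ k = !![ε, 0; 0, ε] := by
    have k00 := congrFun (congrFun key 0) 0
    have k01 := congrFun (congrFun key 0) 1
    have k10 := congrFun (congrFun key 1) 0
    have k11 := congrFun (congrFun key 1) 1
    simp [Matrix.mul_apply, Fin.sum_univ_two, toC_apply, -map_pow] at k00 k01 k10 k11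
    have a10 : ((((Rmat ζ).1 ^ k) 1 0 : Oring ζ) : ℂ) = 0 := by
      apply mul_left_cancel₀ hdiff
      linear_combination k10 - k00
    have a11 : ((((Rmat ζ).1 ^ k) 1 1 : Oring ζ) : ℂ) = ε := by
      apply mul_left_cancel₀ hdiff
      linear_combination k11 - k01
    have a00 : ((((Rmat ζ).1 ^ k) 0 0 : Oring ζ) : ℂ) = ε := by
      linear_combination k00 - (1 + ζ) * a10
    have a01 : ((((Rmat ζ).1 ^ k) 0 1 : Oring ζ) : ℂ) = 0 := by
      linear_combination k01 - (1 + ζ) * a11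
    ext i j
    fin_cases i <;> fin_cases j <;> simp [a00, a01, a10, a11]
  have hmem : ε - 1 ∈ Ideal.span {(2 : Oring ζ)} := by
    rw [Ideal.mem_span_singleton']
    rcases hε with rfl | rfl
    · exact ⟨0, by ring⟩
    · exact ⟨-1, by ring⟩
  rw [SLred_eq_one]
  intro i j
  rw [Matrix.SpecialLinearGroup.coe_pow, hR]
  fin_cases i <;> fin_cases j <;> simp [hmem]

theorem order_R (ζ : ℂ) (n : ℕ) (hn : 3 ≤ n) (hζ : IsPrimitiveRoot ζ n) :
    orderOf (SLred ζ (Ideal.span {(2 : Oring ζ)}) (Rmat ζ)) = nprime n := by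
  apply Nat.dvd_antisymm
  · apply orderOf_dvd_of_pow_eq_one
    rw [← map_pow]
    apply upper ζ n hn hζ
    unfold nprime
    split_ifs with he
    · right
      obtain ⟨m, hm⟩ := he
      have : n / 2 = m := by omega
      rw [this]
      exact (hζ.pow (by omega) (show n = m * 2 by omega)).eq_neg_one_of_two_right
    · left; exact hζ.pow_eq_one
  · have h := lower ζ n hn hζ (orderOf (SLred ζ (Ideal.span {(2 : Oring ζ)}) (Rmat ζ)))
      (by rw [map_pow, pow_orderOf_eq_one])
    unfold nprime
    split_ifs with he
    · obtain ⟨m, hm⟩ := he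
      have h2 : n / 2 = m := by omega
      rw [h2]
      have : 2 * m ∣ 2 * orderOf (SLred ζ (Ideal.span {(2 : Oring ζ)}) (Rmat ζ)) := by
        rwa [show 2 * m = n by omega]
      exact Nat.dvd_of_mul_dvd_mul_left (by norm_num) this
    · rw [Nat.not_even_iff_odd] at he
      exact Nat.Coprime.dvd_of_dvd_mul_left he.coprime_two_right h

theorem T_sq (ζ : ℂ) : SLred ζ (Ideal.span {(2 : Oring ζ)}) (Tmat ζ) *
    SLred ζ (Ideal.span {(2 : Oring ζ)}) (Tmat ζ) = 1 := by
  rw [← map_mul, SLred_eq_one]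
  have : (Tmat ζ * Tmat ζ).1 = (Tmat ζ).1 * (Tmat ζ).1 := rfl
  intro i j
  rw [this, Tmat, Matrix.mul_fin_two, Ideal.mem_span_singleton']
  fin_cases i <;> fin_cases j
  · exact ⟨0, by simp⟩
  · exact ⟨2 + lamO ζ, by simp; ring⟩
  · exact ⟨0, by simp⟩
  · exact ⟨0, by simp⟩

theorem U_sq (ζ : ℂ) : SLred ζ (Ideal.span {(2 : Oring ζ)}) (Umat ζ) *
    SLred ζ (Ideal.span {(2 : Oring ζ)}) (Umat ζ) = 1 := by
  rw [← map_mul, SLred_eq_one]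
  have : (Umat ζ * Umat ζ).1 = (Umat ζ).1 * (Umat ζ).1 := rfl
  intro i j
  rw [this, Umat, Matrix.mul_fin_two, Ideal.mem_span_singleton']
  fin_cases i <;> fin_cases j
  · exact ⟨0, by simp⟩
  · exact ⟨0, by simp⟩
  · exact ⟨-1, by simp; ring⟩
  · exact ⟨0, by simp⟩

theorem image_mod_two_is_dihedral
    (n : ℕ) (hn : 3 ≤ n) (hnot2 : ∀ k : ℕ, n ≠ 2 ^ k)
    (ζ : ℂ) (hζ : IsPrimitiveRoot ζ n) :
    Nonempty (↥((Delta ζ).map (SLred ζ (Ideal.span {(2 : Oring ζ)}))) ≃*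
      DihedralGroup (nprime n)) := by
  have h3 : 3 ≤ nprime n := by
    unfold nprime
    split_ifs with he
    · obtain ⟨m, hm⟩ := he
      have h1 := hnot2 2
      norm_num at h1
      omega
    · exact hn
  have hmap : (Delta ζ).map (SLred ζ (Ideal.span {(2 : Oring ζ)})) =
      Subgroup.closure {SLred ζ (Ideal.span {(2 : Oring ζ)}) (Tmat ζ),
        SLred ζ (Ideal.span {(2 : Oring ζ)}) (Umat ζ)} := by
    rw [Delta, MonoidHom.map_closure, Set.image_pair]
  rw [hmap]
  apply dih_aux _ _ _ (T_sq ζ) (U_sq ζ) h3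
  rw [← map_mul]
  exact order_R ζ n hn hζ

end
end

section
/- Suppose n = 2^k with k ≥ 2. Then for every integer d ≥ 3, the index in SL₂(O/2^d O) of the image of Δ under reduction mod 2^d O equals 3·2^{2^k − k − 2}. -/
open Matrix
open scoped MatrixGroups

set_option synthInstance.maxHeartbeats 1000000
set_option maxHeartbeats 1000000

noncomputable section

/-- A finite chain ring of length `d * e` with residue field of two elements and
uniformizer `p`, in which `2` is `p ^ e` times a unit. -/
structure ChainRing (B : Type*) [CommRing B] (p : B) (e d : ℕ) : Prop where
  fin : Finite B
  res : ∀ x : B, ∃ y, x = p * y ∨ x = 1 + p * y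
  two : ∃ u : Bˣ, (2 : B) = p ^ e * u
  nil : p ^ (d * e) = 0
  card : Nat.card B = 2 ^ (d * e)
  epos : 1 ≤ e
  dge : 3 ≤ d

namespace ChainRing

variable {B : Type*} [CommRing B] {p : B} {e d : ℕ}

theorem isUnit (h : ChainRing B p e d) (y : B) : IsUnit (1 + p * y) := by
  apply IsNilpotent.isUnit_one_add
  exact ⟨d * e, by rw [mul_pow, h.nil, zero_mul]⟩

theorem card_step (h : ChainRing B p e d) (i : ℕ) :
    Nat.card {x : B // p ^ i ∣ x} ≤ 2 * Nat.card {x : B // p ^ (i + 1) ∣ x} := by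
  have := h.fin
  have hb : 2 = Nat.card Bool := by simp
  rw [hb, ← Nat.card_prod]
  let f : Bool × {x : B // p ^ (i + 1) ∣ x} → {x : B // p ^ i ∣ x} := fun q =>
    ⟨(if q.1 then p ^ i else 0) + q.2.1, by
      apply dvd_add
      · split_ifs <;> simp
      · exact (pow_dvd_pow p (Nat.le_succ i)).trans q.2.2⟩
  apply Nat.card_le_card_of_surjective f
  rintro ⟨x, z, rfl⟩
  obtain ⟨y, rfl | rfl⟩ := h.res z
  · refine ⟨(false, ⟨p ^ (i + 1) * y, dvd_mul_right _ _⟩), ?_⟩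
    simp only [f, Subtype.mk.injEq]; simp; ring
  · refine ⟨(true, ⟨p ^ (i + 1) * y, dvd_mul_right _ _⟩), ?_⟩
    simp only [f, Subtype.mk.injEq]; simp; ring

theorem card_dvd (h : ChainRing B p e d) (i : ℕ) (hi : i ≤ d * e) :
    Nat.card {x : B // p ^ i ∣ x} = 2 ^ (d * e - i) := by
  have := h.fin
  have h1 : ∀ m, m ≤ d * e → Nat.card {x : B // p ^ (d * e - m) ∣ x} ≤ 2 ^ m := by
    intro m
    induction m with
    | zero =>
      intro _
      have : Subsingleton {x : B // p ^ (d * e - 0) ∣ x} := by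
        constructor
        rintro ⟨x, hx⟩ ⟨y, hy⟩
        simp only [Nat.sub_zero, h.nil, zero_dvd_iff] at hx hy
        simp [hx, hy]
      exact Finite.card_le_one_iff_subsingleton.mpr this
    | succ m ih =>
      intro hm
      have := h.card_step (d * e - (m + 1))
      rw [show d * e - (m + 1) + 1 = d * e - m by omega] at this
      have := ih (by omega)
      rw [pow_succ]; omega
  have h2 : ∀ i, 2 ^ (d * e) ≤ 2 ^ i * Nat.card {x : B // p ^ i ∣ x} := by
    intro i
    induction i with
    | zero =>
      rw [← h.card, pow_zero, one_mul]
      apply le_of_eq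
      exact Nat.card_congr (Equiv.subtypeUnivEquiv (fun x => by simp)).symm
    | succ i ih =>
      have := h.card_step i
      calc _ ≤ _ := ih
        _ ≤ 2 ^ i * (2 * Nat.card {x : B // p ^ (i + 1) ∣ x}) := by gcongr
        _ = _ := by ring
  apply le_antisymm
  · have := h1 (d * e - i) (by omega)
    rwa [show d * e - (d * e - i) = i by omega] at this
  · have := h2 i
    have h3 : 2 ^ (d * e) = 2 ^ i * 2 ^ (d * e - i) := by rw [← pow_add]; congr 1; omega
    rw [h3] at this
    exact Nat.le_of_mul_le_mul_left this (by positivity)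

theorem not_dvd (h : ChainRing B p e d) (i m : ℕ) (hi : i < d * e) (hm : i < m) :
    ¬ p ^ m ∣ p ^ i := by
  have := h.fin
  intro hd
  have hd : p ^ (i + 1) ∣ p ^ i := (pow_dvd_pow p hm).trans hd
  have h1 := h.card_dvd i hi.le
  have h2 := h.card_dvd (i + 1) hi
  have h3 : Nat.card {x : B // p ^ i ∣ x} = Nat.card {x : B // p ^ (i + 1) ∣ x} :=
    Nat.card_congr (Equiv.subtypeEquivRight fun x =>
      ⟨fun hx => hd.trans hx, fun hx => (pow_dvd_pow p (Nat.le_succ i)).trans hx⟩)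
  rw [h1, h2] at h3
  have := Nat.pow_right_injective le_rfl h3
  omega

theorem dvd_of_mul (h : ChainRing B p e d) (i m : ℕ) (hm : i + m ≤ d * e) (z : B)
    (hz : p ^ i * z = 0) : p ^ m ∣ z := by
  induction m with
  | zero => simp
  | succ m ih =>
    obtain ⟨y, rfl⟩ := ih (by omega)
    obtain ⟨w, rfl | rfl⟩ := h.res y
    · exact ⟨w, by ring⟩
    · exfalso
      rw [← mul_assoc, (h.isUnit w).mul_left_eq_zero, ← pow_add] at hz
      apply h.not_dvd (i + m) (i + m + 1) (by omega) (by omega)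
      rw [hz]; simp

theorem two_pow_dvd (h : ChainRing B p e d) (i : ℕ) (x : B) :
    (2 : B) ^ i ∣ x ↔ p ^ (i * e) ∣ x := by
  obtain ⟨u, hu⟩ := h.two
  rw [hu, mul_pow, ← pow_mul, mul_comm e i]
  rw [← Units.val_pow_eq_pow_val, Units.mul_right_dvd]

theorem two_pow_mul (h : ChainRing B p e d) (i m : ℕ) (x : B) :
    (2 : B) ^ i * p ^ m * x = 0 ↔ p ^ (i * e + m) * x = 0 := by
  obtain ⟨u, hu⟩ := h.two
  rw [hu, mul_pow, ← pow_mul, mul_comm e i, ← Units.val_pow_eq_pow_val]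
  rw [show p ^ (i * e) * ↑(u ^ i) * p ^ m * x = ↑(u ^ i) * (p ^ (i * e + m) * x) by ring]
  exact Units.mul_right_eq_zero _

theorem two_pow_zero (h : ChainRing B p e d) : (2 : B) ^ d = 0 := by
  obtain ⟨u, hu⟩ := h.two
  rw [hu, mul_pow, ← pow_mul, mul_comm e d, h.nil, zero_mul]

theorem p_dvd_two (h : ChainRing B p e d) : p ∣ 2 := by
  obtain ⟨u, hu⟩ := h.two
  rw [hu]
  exact (dvd_pow_self p (by have := h.epos; omega)).mul_right _

/-- induction principle : `B` is additively spanned by the powers of `p`. -/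
theorem induct (h : ChainRing B p e d) (Q : B → Prop) (h0 : Q 0) (h1 : Q 1)
    (ha : ∀ x y, Q x → Q y → Q (x + y)) (hp : ∀ x, Q x → Q (p * x)) (x : B) : Q x := by
  have key : ∀ m : ℕ, ∀ x : B, ∃ z y, Q z ∧ x = z + p ^ m * y := by
    intro m
    induction m with
    | zero => intro x; exact ⟨0, x, h0, by simp⟩
    | succ m ih =>
      intro x
      obtain ⟨w, hw⟩ := h.res x
      obtain ⟨z, y, hz, rfl⟩ := ih w
      rcases hw with rfl | rfl
      · exact ⟨p * z, y, hp _ hz, by ring⟩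
      · exact ⟨1 + p * z, y, ha _ _ h1 (hp _ hz), by ring⟩
  obtain ⟨z, y, hz, hx⟩ := key (d * e) x
  rw [h.nil, zero_mul, add_zero] at hx
  rwa [hx]

end ChainRing


namespace ChainRing

/-- The Iwahori order `[[B, pB], [B, B]]`. -/
def Iw {B : Type*} [CommRing B] (p : B) : Subring (Matrix (Fin 2) (Fin 2) B) where
  carrier := {M | p ∣ M 0 1}
  mul_mem' := by
    intro a b ha hb
    simp only [Set.mem_ofPred_eq, Matrix.mul_apply, Fin.sum_univ_two] at *
    exact dvd_add (hb.mul_left _) (ha.mul_right _)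
  one_mem' := by simp
  add_mem' := by
    intro a b ha hb
    simp only [Set.mem_ofPred_eq, Matrix.add_apply] at *
    exact dvd_add ha hb
  zero_mem' := by simp
  neg_mem' := by
    intro a ha
    simp only [Set.mem_ofPred_eq, Matrix.neg_apply] at *
    exact ha.neg_right

variable {B : Type*} [CommRing B] {p : B} {e d : ℕ}

theorem mem_Iw {M : Matrix (Fin 2) (Fin 2) B} : M ∈ Iw p ↔ p ∣ M 0 1 := Iff.rfl

theorem smul_Iw {M : Matrix (Fin 2) (Fin 2) B} (q : B) (h : M ∈ Iw p) : q • M ∈ Iw p := by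
  rw [mem_Iw] at *
  simpa using h.mul_left q

theorem adj_Iw {M : Matrix (Fin 2) (Fin 2) B} (h : M ∈ Iw p) : M.adjugate ∈ Iw p := by
  rw [mem_Iw] at *
  simpa [Matrix.adjugate_fin_two] using h

theorem inv_Iw {g : SL(2, B)} (h : (g : Matrix (Fin 2) (Fin 2) B) ∈ Iw p) :
    ((g⁻¹ : SL(2, B)) : Matrix (Fin 2) (Fin 2) B) ∈ Iw p := by
  rw [Matrix.SpecialLinearGroup.coe_inv]
  exact adj_Iw h

/-- `M = [[a, p b], [c, a]]`. -/
def mtx (p a b c : B) : Matrix (Fin 2) (Fin 2) B := !![a, p * b; c, a]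

theorem mtx_Iw (a b c : B) : mtx p a b c ∈ Iw p := by
  rw [mem_Iw]; simp [mtx]

/-- some element of `G` is `1 + q M` modulo `2 q` times the Iwahori order. -/
def Lv (p : B) (G : Subgroup SL(2, B)) (q : B) (M : Matrix (Fin 2) (Fin 2) B) : Prop :=
  ∃ h ∈ G, ∃ M' ∈ Iw p, (h : Matrix (Fin 2) (Fin 2) B) = 1 + q • (M + (2 : B) • M')

variable {G : Subgroup SL(2, B)}

theorem Lv.add {q : B} (hq : (2 : B) ∣ q) {M N : Matrix (Fin 2) (Fin 2) B} (hM : M ∈ Iw p)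
    (hN : N ∈ Iw p)
    (h1 : Lv p G q M) (h2 : Lv p G q N) : Lv p G q (M + N) := by
  obtain ⟨g, hg, M', hM', e1⟩ := h1
  obtain ⟨h, hh, N', hN', e2⟩ := h2
  obtain ⟨q', rfl⟩ := hq
  refine ⟨g * h, mul_mem hg hh, M' + N' + q' • ((M + (2 : B) • M') * (N + (2 : B) • N')), ?_, ?_⟩
  · refine add_mem (add_mem hM' hN') (smul_Iw _ (mul_mem ?_ ?_))
    · exact add_mem hM (smul_Iw _ hM')
    · exact add_mem hN (smul_Iw _ hN')
  · rw [Matrix.SpecialLinearGroup.coe_mul, e1, e2]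
    simp only [add_mul, mul_add, one_mul, mul_one, smul_mul_assoc, mul_smul_comm]
    module

theorem Lv.congr {q : B} {M N K : Matrix (Fin 2) (Fin 2) B} (hK : K ∈ Iw p)
    (e1 : N = M + (2 : B) • K) (h1 : Lv p G q M) : Lv p G q N := by
  obtain ⟨g, hg, M', hM', e2⟩ := h1
  refine ⟨g, hg, M' - K, sub_mem hM' hK, ?_⟩
  rw [e2, e1]; module

theorem Lv.sq2 {M : Matrix (Fin 2) (Fin 2) B} (hM : M ∈ Iw p) (h1 : Lv p G 2 M) :
    Lv p G 4 (M + M * M) := by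
  obtain ⟨g, hg, M', hM', e2⟩ := h1
  refine ⟨g * g, mul_mem hg hg, M' + M * M' + M' * M + (2 : B) • (M' * M'), ?_, ?_⟩
  · exact add_mem (add_mem (add_mem hM' (mul_mem hM hM')) (mul_mem hM' hM))
      (smul_Iw _ (mul_mem hM' hM'))
  · rw [Matrix.SpecialLinearGroup.coe_mul, e2]
    simp only [add_mul, mul_add, one_mul, mul_one, smul_mul_assoc, mul_smul_comm]
    module

theorem Lv.sq4 {q : B} (hq : (4 : B) ∣ q) {M : Matrix (Fin 2) (Fin 2) B} (hM : M ∈ Iw p)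
    (h1 : Lv p G q M) : Lv p G (2 * q) M := by
  obtain ⟨g, hg, M', hM', e2⟩ := h1
  obtain ⟨q', rfl⟩ := hq
  refine ⟨g * g, mul_mem hg hg, M' + q' • ((M + (2 : B) • M') * (M + (2 : B) • M')), ?_, ?_⟩
  · have : M + (2 : B) • M' ∈ Iw p := add_mem hM (smul_Iw _ hM')
    exact add_mem hM' (smul_Iw _ (mul_mem this this))
  · rw [Matrix.SpecialLinearGroup.coe_mul, e2]
    simp only [add_mul, mul_add, one_mul, mul_one, smul_mul_assoc, mul_smul_comm]
    module

theorem Lv.conj {q : B} {M : Matrix (Fin 2) (Fin 2) B} {t : SL(2, B)} (ht : t ∈ G)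
    (htI : (t : Matrix (Fin 2) (Fin 2) B) ∈ Iw p) (h1 : Lv p G q M) :
    Lv p G q ((t : Matrix (Fin 2) (Fin 2) B) * M *
      ((t⁻¹ : SL(2, B)) : Matrix (Fin 2) (Fin 2) B)) := by
  obtain ⟨g, hg, M', hM', e2⟩ := h1
  refine ⟨t * g * t⁻¹, mul_mem (mul_mem ht hg) (inv_mem ht), (t : Matrix (Fin 2) (Fin 2) B) * M' *
      ((t⁻¹ : SL(2, B)) : Matrix (Fin 2) (Fin 2) B), mul_mem (mul_mem htI hM') (inv_Iw htI), ?_⟩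
  rw [Matrix.SpecialLinearGroup.coe_mul, Matrix.SpecialLinearGroup.coe_mul, e2]
  have : (t : Matrix (Fin 2) (Fin 2) B) * ((t⁻¹ : SL(2, B)) : Matrix (Fin 2) (Fin 2) B) = 1 := by
    rw [← Matrix.SpecialLinearGroup.coe_mul, mul_inv_cancel]; simp
  simp only [add_mul, mul_add, mul_one, smul_mul_assoc, mul_smul_comm, this, smul_add]

theorem inv_form {q : B} {P : Matrix (Fin 2) (Fin 2) B} {g : SL(2, B)}
    (e1 : (g : Matrix (Fin 2) (Fin 2) B) = 1 + q • P) :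
    ((g⁻¹ : SL(2, B)) : Matrix (Fin 2) (Fin 2) B) = 1 + q • P.adjugate := by
  rw [Matrix.SpecialLinearGroup.coe_inv, e1]
  ext i j
  fin_cases i <;> fin_cases j <;> simp [Matrix.adjugate_fin_two]

theorem Lv.comm {M N : Matrix (Fin 2) (Fin 2) B} (hM : M ∈ Iw p) (hN : N ∈ Iw p)
    (h1 : Lv p G 2 M) (h2 : Lv p G 2 N) : Lv p G 4 (M * N - N * M) := by
  obtain ⟨g, hg, M', hM', e1⟩ := h1
  obtain ⟨h, hh, N', hN', e2⟩ := h2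
  have f1 := inv_form e1
  have f2 := inv_form e2
  have hP : M + (2 : B) • M' ∈ Iw p := add_mem hM (smul_Iw _ hM')
  have hQ : N + (2 : B) • N' ∈ Iw p := add_mem hN (smul_Iw _ hN')
  set P := M + (2 : B) • M' with hPd
  set Q := N + (2 : B) • N' with hQd
  have e3 : ((g * h * g⁻¹ * h⁻¹ : SL(2, B)) : Matrix (Fin 2) (Fin 2) B)
      = 1 + (4 : B) • ((P * Q - Q * P) * (((g⁻¹ : SL(2, B)) : Matrix (Fin 2) (Fin 2) B) *
        ((h⁻¹ : SL(2, B)) : Matrix (Fin 2) (Fin 2) B))) := by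
    have a1 : (g : Matrix (Fin 2) (Fin 2) B) * h = h * g + (4 : B) • (P * Q - Q * P) := by
      rw [e1, e2]
      simp only [add_mul, mul_add, one_mul, mul_one, smul_mul_assoc, mul_smul_comm]
      module
    have a2 : (h : Matrix (Fin 2) (Fin 2) B) * g * ((g⁻¹ : SL(2, B)) : Matrix (Fin 2) (Fin 2) B) *
        ((h⁻¹ : SL(2, B)) : Matrix (Fin 2) (Fin 2) B) = 1 := by
      simp only [← Matrix.SpecialLinearGroup.coe_mul]; simp
    rw [Matrix.SpecialLinearGroup.coe_mul, Matrix.SpecialLinearGroup.coe_mul,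
      Matrix.SpecialLinearGroup.coe_mul, a1, add_mul, add_mul, a2, smul_mul_assoc, smul_mul_assoc,
      mul_assoc]
  have hP' := adj_Iw hP
  have hQ' := adj_Iw hQ
  set P' := P.adjugate
  set Q' := Q.adjugate
  have hC : P * Q - Q * P ∈ Iw p := sub_mem (mul_mem hP hQ) (mul_mem hQ hP)
  refine ⟨g * h * g⁻¹ * h⁻¹, mul_mem (mul_mem (mul_mem hg hh) (inv_mem hg)) (inv_mem hh),
    (M * N' + M' * N + (2 : B) • (M' * N')) - (N * M' + N' * M + (2 : B) • (N' * M'))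
      + (P * Q - Q * P) * (P' + Q' + (2 : B) • (P' * Q')), ?_, ?_⟩
  · refine add_mem (sub_mem (add_mem (add_mem ?_ ?_) (smul_Iw _ ?_))
      (add_mem (add_mem ?_ ?_) (smul_Iw _ ?_))) (mul_mem hC (add_mem (add_mem hP' hQ')
        (smul_Iw _ (mul_mem hP' hQ'))))
    all_goals apply mul_mem <;> assumption
  · rw [e3, f1, f2]
    have : P * Q - Q * P = M * N - N * M + (2 : B) •
      ((M * N' + M' * N + (2 : B) • (M' * N')) - (N * M' + N' * M + (2 : B) • (N' * M'))) := by
      rw [hPd, hQd]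
      simp only [add_mul, mul_add, one_mul, mul_one, smul_mul_assoc, mul_smul_comm]
      module
    generalize hC' : P * Q - Q * P = C at *
    generalize (M * N' + M' * N + (2 : B) • (M' * N')) - (N * M' + N' * M + (2 : B) • (N' * M'))
      = D at *
    have h5 : M * N - N * M = C - (2 : B) • D := by rw [this]; module
    rw [h5]
    simp only [add_mul, mul_add, one_mul, mul_one, smul_mul_assoc, mul_smul_comm]
    module

end ChainRing


namespace ChainRing

variable {B : Type*} [CommRing B] {p : B} {e d : ℕ} {G : Subgroup SL(2, B)}

/-- The matrix `T`. -/
def Tm (p : B) : SL(2, B) := ⟨!![1, p; 0, 1], by rw [Matrix.det_fin_two_of]; ring⟩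

/-- The matrix `U`. -/
def Um (B : Type*) [CommRing B] : SL(2, B) :=
  ⟨!![-1, 0; 1, -1], by rw [Matrix.det_fin_two_of]; ring⟩

theorem Tm_coe : (Tm p : Matrix (Fin 2) (Fin 2) B) = !![1, p; 0, 1] := rfl
theorem Um_coe : (Um B : Matrix (Fin 2) (Fin 2) B) = !![-1, 0; 1, -1] := rfl

theorem Tm_Iw : (Tm p : Matrix (Fin 2) (Fin 2) B) ∈ Iw p := by
  rw [mem_Iw, Tm_coe]; simp
theorem Um_Iw : (Um B : Matrix (Fin 2) (Fin 2) B) ∈ Iw p := by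
  rw [mem_Iw, Um_coe]; simp

theorem unit_form (h : ChainRing B p e d) {x : B} (hx : IsUnit x) : ∃ z, x = 1 + p * z := by
  obtain ⟨y, hy | hy⟩ := h.res x
  · rw [hy] at hx
    have h1 := isUnit_of_mul_isUnit_left hx
    have h2 := h1.pow (d * e)
    rw [h.nil, isUnit_zero_iff] at h2
    exact ⟨0, (eq_of_zero_eq_one h2 _ _)⟩
  · exact ⟨y, hy⟩

theorem diag_Iw (z w : B) : !![w, 0; 0, z] ∈ Iw p := by rw [mem_Iw]; simp

theorem Lv.addm {q : B} (hq : (2 : B) ∣ q) {a b c a' b' c' : B}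
    (h1 : Lv p G q (mtx p a b c)) (h2 : Lv p G q (mtx p a' b' c')) :
    Lv p G q (mtx p (a + a') (b + b') (c + c')) := by
  have := h1.add hq (mtx_Iw _ _ _) (mtx_Iw _ _ _) h2
  convert this using 1
  ext i j
  fin_cases i <;> fin_cases j <;> simp [mtx]; ring

theorem Lv.congrm {q : B} {a b c a' b' c' : B}
    (h1 : Lv p G q (mtx p a b c)) (x y z : B) (e1 : a' = a + 2 * x) (e2 : b' = b + 2 * y)
    (e3 : c' = c + 2 * z) : Lv p G q (mtx p a' b' c') := by
  refine h1.congr (mtx_Iw x y z) ?_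
  subst e1 e2 e3
  ext i j
  fin_cases i <;> fin_cases j <;> simp [mtx]; ring

theorem Lv.T (hT : Tm p ∈ G) {a b c : B} (h1 : Lv p G 2 (mtx p a b c)) :
    Lv p G 2 (mtx p (p * c) (p * c) 0) := by
  have h2 := h1.conj hT Tm_Iw
  have h3 : Lv p G 2 (mtx p (a + p * c) (b - p * c) c) := by
    refine h2.congr (diag_Iw (p * c) 0) ?_
    rw [Matrix.SpecialLinearGroup.coe_inv, Tm_coe]
    ext i j
    fin_cases i <;> fin_cases j <;>
      simp [mtx, Matrix.adjugate_fin_two, Matrix.mul_apply, Fin.sum_univ_two] <;> ring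
  exact (h1.addm dvd_rfl h3).congrm (-a) (p * c - b) (-c) (by ring) (by ring) (by ring)

theorem Lv.U (hU : Um B ∈ G) {a b c : B} (h1 : Lv p G 2 (mtx p a b c)) :
    Lv p G 2 (mtx p (p * b) 0 (p * b)) := by
  have h2 := h1.conj hU Um_Iw
  have h3 : Lv p G 2 (mtx p (a + p * b) b (c - p * b)) := by
    refine h2.congr (diag_Iw (p * b) 0) ?_
    rw [Matrix.SpecialLinearGroup.coe_inv, Um_coe]
    ext i j
    fin_cases i <;> fin_cases j <;>
      simp [mtx, Matrix.adjugate_fin_two, Matrix.mul_apply, Fin.sum_univ_two] <;> ring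
  exact (h1.addm dvd_rfl h3).congrm (-a) (- b) (p * b -c) (by ring) (by ring) (by ring)

theorem Lv.base1 (hn : (-1 : SL(2, B)) ∈ G) : Lv p G 2 (mtx p 1 0 0) := by
  refine ⟨-1, hn, !![-1, 0; 0, -1], diag_Iw _ _, ?_⟩
  ext i j
  fin_cases i <;> fin_cases j <;> simp [mtx]; ring_nf; ring

theorem Lv.base2 (hT : Tm p ∈ G) : Lv p G 2 (mtx p 0 1 0) := by
  refine ⟨Tm p * Tm p, mul_mem hT hT, 0, zero_mem _, ?_⟩
  rw [Matrix.SpecialLinearGroup.coe_mul, Tm_coe]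
  ext i j
  fin_cases i <;> fin_cases j <;> simp [mtx]; ring

theorem Lv.base3 (hU : Um B ∈ G) : Lv p G 2 (mtx p 0 0 1) := by
  refine ⟨Um B * Um B, mul_mem hU hU, !![0, 0; -1, 0], by simp [mem_Iw], ?_⟩
  rw [Matrix.SpecialLinearGroup.coe_mul, Um_coe]
  ext i j
  fin_cases i <;> fin_cases j <;> simp [mtx]; ring

theorem Lv.zero {q : B} : Lv p G q (mtx p 0 0 0) := by
  refine ⟨1, one_mem _, 0, zero_mem _, ?_⟩
  ext i j
  fin_cases i <;> fin_cases j <;> simp [mtx]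

/-- First layer. -/
theorem layer2 (h : ChainRing B p e d) (hn : (-1 : SL(2, B)) ∈ G) (hT : Tm p ∈ G)
    (hU : Um B ∈ G) (s : B) : Lv p G 2 (mtx p s s 0) ∧ Lv p G 2 (mtx p s 0 s) := by
  refine h.induct (fun s => Lv p G 2 (mtx p s s 0) ∧ Lv p G 2 (mtx p s 0 s)) ?_ ?_ ?_ ?_ s
  · exact ⟨Lv.zero, Lv.zero⟩
  · constructor
    · simpa using (Lv.base1 hn).addm dvd_rfl (Lv.base2 hT)
    · simpa using (Lv.base1 hn).addm dvd_rfl (Lv.base3 hU)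
  · rintro x y ⟨h1, h2⟩ ⟨h3, h4⟩
    exact ⟨by simpa using h1.addm dvd_rfl h3, by simpa using h2.addm dvd_rfl h4⟩
  · rintro x ⟨h1, h2⟩
    exact ⟨h2.T hT, h1.U hU⟩

theorem layer2' (h : ChainRing B p e d) (hn : (-1 : SL(2, B)) ∈ G) (hT : Tm p ∈ G)
    (hU : Um B ∈ G) (b c : B) (i : ℤ) : Lv p G 2 (mtx p (b + c + i) b c) := by
  have h1 := (layer2 h hn hT hU b).1
  have h2 := (layer2 h hn hT hU c).2
  have h3 := h1.addm dvd_rfl h2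
  obtain ⟨m, rfl | rfl⟩ := Int.even_or_odd' i
  · refine h3.congrm m 0 0 ?_ (by ring) (by ring)
    push_cast; ring
  · refine (h3.addm dvd_rfl (Lv.base1 hn)).congrm m 0 0 ?_ (by ring) (by ring)
    push_cast; ring

/-- Second layer. -/
theorem layer4 (h : ChainRing B p e d) (hn : (-1 : SL(2, B)) ∈ G) (hT : Tm p ∈ G)
    (hU : Um B ∈ G) (hW : ∃ W ∈ G, (W : Matrix (Fin 2) (Fin 2) B) ∈ Iw p ∧ ∃ w : B, IsUnit w ∧
      W 0 0 + W 1 1 = 4 * w) (a b c : B) : Lv p G 4 (mtx p a b c) := by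
  have d4 : (2 : B) ∣ 4 := ⟨2, by norm_num⟩
  have k1 : ∀ s, Lv p G 4 (mtx p (p * s) 0 0) := by
    intro s
    have h1 := Lv.comm (mtx_Iw _ _ _) (mtx_Iw _ _ _) (layer2 h hn hT hU s).1
      (layer2 h hn hT hU 1).2
    refine h1.congr (diag_Iw (p * s) 0) ?_
    ext i j
    fin_cases i <;> fin_cases j <;> simp [mtx] <;> ring
  have k2 : ∀ s, Lv p G 4 (mtx p 0 s 0) := by
    intro s
    have h1 := Lv.sq2 (mtx_Iw _ _ _) (layer2 h hn hT hU s).1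
    obtain ⟨z, hz⟩ : ∃ z, s + s * s = p * z := by
      obtain ⟨y, rfl | rfl⟩ := h.res s
      · exact ⟨y + y * p * y, by ring⟩
      · obtain ⟨t, ht⟩ := h.p_dvd_two
        exact ⟨t + p * y * y + 3 * y, by linear_combination ht⟩
    have h2 : Lv p G 4 (mtx p (s + s * s) s 0) := by
      refine h1.congr (mtx_Iw 0 (- s * s) 0) ?_
      ext i j
      fin_cases i <;> fin_cases j <;> simp [mtx] <;> ring
    exact (h2.addm d4 (k1 z)).congrm (- (s + s * s)) 0 0 (by rw [← hz]; ring) (by ring) (by ring)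
  have k3 : ∀ s, Lv p G 4 (mtx p 0 0 s) := by
    intro s
    have h1 := Lv.sq2 (mtx_Iw _ _ _) (layer2 h hn hT hU s).2
    obtain ⟨z, hz⟩ : ∃ z, s + s * s = p * z := by
      obtain ⟨y, rfl | rfl⟩ := h.res s
      · exact ⟨y + y * p * y, by ring⟩
      · obtain ⟨t, ht⟩ := h.p_dvd_two
        exact ⟨t + p * y * y + 3 * y, by linear_combination ht⟩
    have h2 : Lv p G 4 (mtx p (s + s * s) 0 s) := by
      refine h1.congr (mtx_Iw 0 0 (- s * s)) ?_
      ext i j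
      fin_cases i <;> fin_cases j <;> simp [mtx] <;> ring
    exact (h2.addm d4 (k1 z)).congrm (- (s + s * s)) 0 0 (by rw [← hz]; ring) (by ring) (by ring)
  have k4 : Lv p G 4 (mtx p 1 0 0) := by
    obtain ⟨W, hWG, hWI, w, hw, htr⟩ := hW
    obtain ⟨b, hb⟩ := hWI
    have hdet : W 0 0 * W 1 1 - W 0 1 * W 1 0 = 1 := by
      rw [← Matrix.det_fin_two]; exact W.2
    have hb' : W 0 1 = p * b := hb
    have hd : W 1 1 = 4 * w - W 0 0 := by rw [← htr]; ring
    have hu : IsUnit (W 0 0) := by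
      apply isUnit_of_mul_isUnit_left (y := W 1 1)
      rw [show W 0 0 * W 1 1 = 1 + p * (b * W 1 0) by rw [hb'] at hdet; linear_combination hdet]
      exact h.isUnit _
    obtain ⟨z, hz⟩ := h.unit_form ((hw.mul hu).neg)
    have h1 : Lv p G 4 (mtx p (-(w * W 0 0)) (- w * b) (- w * W 1 0)) := by
      refine ⟨-1 * (W * W), mul_mem hn (mul_mem hWG hWG), !![0, 0; 0, - w * (2 * w - W 0 0)],
        diag_Iw _ _, ?_⟩
      rw [hb', hd] at hdet
      ext i j
      fin_cases i <;> fin_cases j <;> simp [mtx, Matrix.mul_apply, Fin.sum_univ_two]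
      · rw [hb']; linear_combination hdet
      · rw [hb', hd]; ring
      · rw [hd]; ring
      · rw [hb', hd]; linear_combination hdet
    rw [hz] at h1
    refine ((((h1.addm d4 (k1 (-z))).addm d4 (k2 (w * b))).addm d4 (k3 (w * W 1 0)))).congrm 0 0 0
      ?_ ?_ ?_ <;> ring
  obtain ⟨y, hy⟩ := h.res a
  have k5 : Lv p G 4 (mtx p a 0 0) := by
    rcases hy with rfl | rfl
    · exact k1 _
    · simpa using k4.addm d4 (k1 y)
  simpa using (k5.addm d4 (k2 b)).addm d4 (k3 c)

theorem layer (h : ChainRing B p e d) (hn : (-1 : SL(2, B)) ∈ G) (hT : Tm p ∈ G)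
    (hU : Um B ∈ G) (hW : ∃ W ∈ G, (W : Matrix (Fin 2) (Fin 2) B) ∈ Iw p ∧ ∃ w : B, IsUnit w ∧
      W 0 0 + W 1 1 = 4 * w) (r : ℕ) (a b c : B) : Lv p G (2 ^ (r + 2)) (mtx p a b c) := by
  induction r with
  | zero => 
    have := layer4 h hn hT hU hW a b c
    norm_num; exact this
  | succ r ih =>
    have := ih.sq4 ⟨2 ^ r, by ring⟩ (mtx_Iw _ _ _)
    rwa [show (2 : B) ^ (r + 1 + 2) = 2 * 2 ^ (r + 2) by ring]

theorem diff_form {q : B} {g g' : SL(2, B)} {M : Matrix (Fin 2) (Fin 2) B} (hM : M ∈ Iw p)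
    (hg' : (g' : Matrix (Fin 2) (Fin 2) B) ∈ Iw p)
    (e1 : (g : Matrix (Fin 2) (Fin 2) B) = g' + q • M) :
    ∃ M' ∈ Iw p, ((g * g'⁻¹ : SL(2, B)) : Matrix (Fin 2) (Fin 2) B) = 1 + q • M' := by
  refine ⟨M * ((g'⁻¹ : SL(2, B)) : Matrix (Fin 2) (Fin 2) B), mul_mem hM (inv_Iw hg'), ?_⟩
  have : (g' : Matrix (Fin 2) (Fin 2) B) * ((g'⁻¹ : SL(2, B)) : Matrix (Fin 2) (Fin 2) B) = 1 := by
    rw [← Matrix.SpecialLinearGroup.coe_mul, mul_inv_cancel]; simp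
  rw [Matrix.SpecialLinearGroup.coe_mul, e1, add_mul, this, smul_mul_assoc]

theorem A4 (h : ChainRing B p e d) (hn : (-1 : SL(2, B)) ∈ G) (hT : Tm p ∈ G)
    (hU : Um B ∈ G) (hW : ∃ W ∈ G, (W : Matrix (Fin 2) (Fin 2) B) ∈ Iw p ∧ ∃ w : B, IsUnit w ∧
      W 0 0 + W 1 1 = 4 * w) (i : ℕ) (hi : i + 2 ≤ d) (g : SL(2, B))
    (M : Matrix (Fin 2) (Fin 2) B) (hM : M ∈ Iw p)
    (e1 : (g : Matrix (Fin 2) (Fin 2) B) = 1 + (2 : B) ^ (d - i) • M) : g ∈ G := by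
  induction i generalizing g M with
  | zero =>
    have : g = 1 := by
      apply Subtype.ext
      rw [e1, Nat.sub_zero, h.two_pow_zero]; simp
    rw [this]; exact one_mem _
  | succ i ih =>
    obtain ⟨r, hr⟩ : ∃ r, d = r + 2 + (i + 1) := ⟨d - (i + 1) - 2, by omega⟩
    have hr1 : d - (i + 1) = r + 2 := by omega
    have hr2 : d - i = r + 3 := by omega
    rw [hr1] at e1
    rw [hr2] at ih
    obtain ⟨b, hb⟩ := hM
    have hdet : g 0 0 * g 1 1 - g 0 1 * g 1 0 = 1 := by
      rw [← Matrix.det_fin_two]; exact g.2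
    have htr : (2 : B) ∣ M 0 0 + M 1 1 := by
      rw [e1] at hdet
      simp only [Matrix.add_apply, Matrix.smul_apply, smul_eq_mul, Matrix.one_apply_eq,
        ne_eq, zero_ne_one, not_false_eq_true, Matrix.one_apply_ne, one_ne_zero] at hdet
      have h1 : (2 : B) ^ (r + 2) * p ^ 0 * (M 0 0 + M 1 1 + (2 : B) ^ (r + 2) *
        (M 0 0 * M 1 1 - M 0 1 * M 1 0)) = 0 := by linear_combination hdet
      rw [h.two_pow_mul] at h1
      have h2 := h.dvd_of_mul _ (1 * e) (by rw [hr]; nlinarith [h.epos]) _ h1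
      rw [← h.two_pow_dvd, pow_one] at h2
      exact (dvd_add_left ((dvd_pow_self (2 : B) (by omega)).mul_right _)).mp h2
    obtain ⟨y, hy⟩ := htr
    obtain ⟨g', hg', M', hM', e2⟩ := layer h hn hT hU hW r (M 0 0) b (M 1 0)
    have hMe : M = mtx p (M 0 0) b (M 1 0) + (2 : B) • !![0, 0; 0, y - M 0 0] := by
      ext i j
      fin_cases i <;> fin_cases j <;> simp [mtx, hb]
      linear_combination hy
    obtain ⟨M'', hM'', e3⟩ := diff_form (p := p) (g := g) (g' := g') (q := (2 : B) ^ (r + 3))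
      (M := !![0, 0; 0, y - M 0 0] - M') (sub_mem (diag_Iw _ _) hM')
      (by rw [e2]; exact add_mem (one_mem _) (smul_Iw _ (add_mem (mtx_Iw _ _ _) (smul_Iw _ hM'))))
      (by
        rw [e1, e2]
        conv_lhs => rw [hMe]
        module)
    have := mul_mem (ih (by omega) _ _ hM'' e3) hg'
    simpa using this

end ChainRing


theorem dihedral_card {Q : Type*} [Group Q] (t u : Q) (j : ℕ) (ht : t * t = 1) (hu : u * u = 1)
    (htop : Subgroup.closure {t, u} = ⊤) (hr1 : (u * t) ^ (2 ^ (j + 1)) = 1)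
    (hr2 : (u * t) ^ (2 ^ j) ≠ 1) (ht1 : t ≠ 1) (htJ : t ≠ (u * t) ^ (2 ^ j)) :
    Nat.card Q = 2 ^ (j + 2) := by
  set r := u * t with hr
  have hord : orderOf r = 2 ^ (j + 1) := orderOf_eq_prime_pow hr2 hr1
  have htinv : t⁻¹ = t := inv_eq_of_mul_eq_one_left ht
  have huinv : u⁻¹ = u := inv_eq_of_mul_eq_one_left hu
  have hconj1 : t * r * t⁻¹ = r⁻¹ := by
    rw [hr, _root_.mul_inv_rev, htinv, huinv]
    simp [mul_assoc, ht]
  have hconj : ∀ z ∈ Subgroup.zpowers r, t * z * t ∈ Subgroup.zpowers r := by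
    rintro _ ⟨i, rfl⟩
    refine ⟨-i, ?_⟩
    have := conj_zpow (a := t) (b := r) (i := i)
    rw [hconj1, _root_.inv_zpow, htinv] at this
    simpa using this
  have htZ : t ∉ Subgroup.zpowers r := by
    rintro ⟨i, hi⟩
    simp only at hi
    have h1 : r ^ (i * 2) = 1 := by rw [_root_.zpow_mul, hi, zpow_two, ht]
    rw [← orderOf_dvd_iff_zpow_eq_one, hord] at h1
    push_cast at h1
    rw [pow_succ] at h1
    obtain ⟨l, rfl⟩ := Int.dvd_of_mul_dvd_mul_right (by norm_num) h1
    have h2 : (r ^ (2 ^ j)) * (r ^ (2 ^ j)) = 1 := by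
      rw [← pow_add, ← hr1]; congr 1; ring
    rw [_root_.zpow_mul] at hi
    have h3 : r ^ ((2 : ℤ) ^ j) = r ^ (2 ^ j) := by
      rw [← zpow_natCast]; congr 1
    rw [h3] at hi
    obtain ⟨m, rfl | rfl⟩ := Int.even_or_odd' l
    · rw [_root_.zpow_mul, zpow_two, h2, _root_.one_zpow] at hi
      exact ht1 hi.symm
    · rw [_root_.zpow_add, _root_.zpow_mul, zpow_two, h2, _root_.one_zpow, one_mul, zpow_one] at hi
      exact htJ hi.symm
  have hall : ∀ b : Q, b ∈ Subgroup.zpowers r ∨ b * t ∈ Subgroup.zpowers r := by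
    intro b
    have hb : b ∈ Subgroup.closure {t, u} := by rw [htop]; trivial
    induction hb using Subgroup.closure_induction with
    | mem x hx =>
      rcases hx with rfl | rfl
      · right; rw [ht]; exact one_mem _
      · right; exact Subgroup.mem_zpowers _
    | one => left; exact one_mem _
    | mul x y _ _ h1 h2 =>
      rcases h1 with h1 | h1 <;> rcases h2 with h2 | h2
      · left; exact mul_mem h1 h2
      · right; rw [mul_assoc]; exact mul_mem h1 h2
      · right
        have := mul_mem h1 (hconj y h2)
        rwa [show x * t * (t * y * t) = x * (t * t) * y * t by simp only [mul_assoc], ht, mul_one]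
          at this
      · left
        have := mul_mem h1 (hconj _ h2)
        rwa [show x * t * (t * (y * t) * t) = x * (t * t) * y * (t * t) by simp only [mul_assoc],
          ht, mul_one, mul_one] at this
    | inv x _ h1 =>
      rcases h1 with h1 | h1
      · left; exact inv_mem h1
      · right
        have := hconj _ (inv_mem h1)
        rw [_root_.mul_inv_rev, htinv, ← mul_assoc, ht, one_mul] at this
        exact this
  have hidx : (Subgroup.zpowers r).index = 2 := by
    rw [Subgroup.index_eq_two_iff]
    refine ⟨t, fun b => ?_⟩
    rcases hall b with h1 | h1
    · right
      refine ⟨h1, fun h2 => htZ ?_⟩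
      have := mul_mem (inv_mem h1) h2
      simpa using this
    · left
      refine ⟨h1, fun h2 => htZ ?_⟩
      have := mul_mem (inv_mem h2) h1
      simpa using this
  rw [← Subgroup.card_mul_index (Subgroup.zpowers r), hidx, Nat.card_zpowers, hord]
  ring

namespace ChainRing

variable {B : Type*} [CommRing B] {p : B} {e d : ℕ} {G : Subgroup SL(2, B)}

/-- the explicit normal subgroup `A_S` of `Δ`. -/
def AS (p : B) : Subgroup SL(2, B) where
  carrier := {g | ∃ b c y z : B, ∃ i : ℤ, g 0 0 = 1 + 2 * (b + c + i) + 4 * y ∧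
    g 0 1 = 2 * p * b ∧ g 1 0 = 2 * c ∧ g 1 1 = 1 + 2 * (b + c + i) + 4 * z}
  one_mem' := ⟨0, 0, 0, 0, 0, by simp⟩
  mul_mem' := by
    rintro g g' ⟨b, c, y, z, i, h00, h01, h10, h11⟩ ⟨b', c', y', z', i', h00', h01', h10', h11'⟩
    refine ⟨b + b' + (2 * (b + c + i) + 4 * y) * b' + b * (2 * (b' + c' + i') + 4 * z'),
      c + c' + c * (2 * (b' + c' + i') + 4 * y') + (2 * (b + c + i) + 4 * z) * c',
      y + y' + (b + c + i + 2 * y) * (b' + c' + i' + 2 * y') + p * b * c'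
        - ((b + c + i + 2 * y) * b' + b * (b' + c' + i' + 2 * z') + c * (b' + c' + i' + 2 * y')
          + (b + c + i + 2 * z) * c'),
      z + z' + (b + c + i + 2 * z) * (b' + c' + i' + 2 * z') + p * c * b'
        - ((b + c + i + 2 * y) * b' + b * (b' + c' + i' + 2 * z') + c * (b' + c' + i' + 2 * y')
          + (b + c + i + 2 * z) * c'), i + i', ?_, ?_, ?_, ?_⟩
    all_goals
      simp only [Matrix.SpecialLinearGroup.coe_mul, Matrix.mul_apply, Fin.sum_univ_two, h00, h01,
        h10, h11, h00', h01', h10', h11']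
      push_cast
      ring
  inv_mem' := by
    rintro g ⟨b, c, y, z, i, h00, h01, h10, h11⟩
    refine ⟨-b, -c, z + b + c + i, y + b + c + i, -i, ?_, ?_, ?_, ?_⟩
    all_goals
      simp [Matrix.SpecialLinearGroup.coe_inv, Matrix.adjugate_fin_two, h00, h01, h10, h11]
      try ring

theorem mem_AS {g : SL(2, B)} : g ∈ AS p ↔ ∃ b c y z : B, ∃ i : ℤ,
    g 0 0 = 1 + 2 * (b + c + i) + 4 * y ∧
    g 0 1 = 2 * p * b ∧ g 1 0 = 2 * c ∧ g 1 1 = 1 + 2 * (b + c + i) + 4 * z := Iff.rfl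

theorem AS_T {g : SL(2, B)} (hg : g ∈ AS p) : Tm p * g * (Tm p)⁻¹ ∈ AS p := by
  obtain ⟨b, c, y, z, i, h00, h01, h10, h11⟩ := hg
  refine ⟨b - p * c + 2 * (z - y), c, y + p * c - (z - y), y, i, ?_, ?_, ?_, ?_⟩
  all_goals
    simp [Matrix.SpecialLinearGroup.coe_mul, Matrix.mul_apply, Fin.sum_univ_two, Tm_coe,
      Matrix.adjugate_fin_two, Matrix.vecMul, dotProduct, h00, h01, h10, h11]
    try ring

theorem AS_U {g : SL(2, B)} (hg : g ∈ AS p) : Um B * g * (Um B)⁻¹ ∈ AS p := by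
  obtain ⟨b, c, y, z, i, h00, h01, h10, h11⟩ := hg
  refine ⟨b, c + 2 * (z - y) - p * b, y + p * b - (z - y), y, i, ?_, ?_, ?_, ?_⟩
  all_goals
    simp [Matrix.SpecialLinearGroup.coe_mul, Matrix.mul_apply, Fin.sum_univ_two, Um_coe,
      Matrix.adjugate_fin_two, Matrix.vecMul, dotProduct, h00, h01, h10, h11]
    try ring

theorem AS_le (h : ChainRing B p e d) (hn : (-1 : SL(2, B)) ∈ G) (hT : Tm p ∈ G)
    (hU : Um B ∈ G) (hW : ∃ W ∈ G, (W : Matrix (Fin 2) (Fin 2) B) ∈ Iw p ∧ ∃ w : B, IsUnit w ∧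
      W 0 0 + W 1 1 = 4 * w) : AS p ≤ G := by
  rintro g ⟨b, c, y, z, i, h00, h01, h10, h11⟩
  obtain ⟨g', hg', M', hM', e2⟩ := layer2' h hn hT hU b c i
  have e1 : (g : Matrix (Fin 2) (Fin 2) B) = 1 + (2 : B) • (mtx p (b + c + i) b c +
      (2 : B) • !![y, 0; 0, z]) := by
    ext i j
    fin_cases i <;> fin_cases j <;> simp [mtx, h00, h01, h10, h11] <;> ring
  obtain ⟨M'', hM'', e3⟩ := diff_form (p := p) (g := g) (g' := g') (q := (2 : B) ^ 2)
      (M := !![y, 0; 0, z] - M') (sub_mem (diag_Iw _ _) hM')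
      (by rw [e2]; exact add_mem (one_mem _) (smul_Iw _ (add_mem (mtx_Iw _ _ _) (smul_Iw _ hM'))))
      (by
        rw [e1, e2]
        module)
  have hd := h.dge
  have := mul_mem (A4 h hn hT hU hW (d - 2) (by omega) _ M'' hM'' (by
    rw [show d - (d - 2) = 2 by omega]; exact e3)) hg'
  simpa using this

/-- iterates of `x ↦ x ^ 2 - 2`, starting from `p - 2`. -/
def tr (p : B) : ℕ → B
  | 0 => p - 2
  | (i + 1) => tr p i ^ 2 - 2

theorem R_pow (i : ℕ) : ∃ g : SL(2, B), g = (Um B * Tm p) ^ (2 ^ i) ∧ g 0 0 + g 1 1 = tr p i ∧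
    g 1 0 = ∏ l ∈ Finset.range i, tr p l := by
  refine ⟨_, rfl, ?_⟩
  induction i with
  | zero => simp [Um_coe, Tm_coe, tr]; ring
  | succ i ih =>
    rw [pow_succ 2, pow_mul, pow_two]
    obtain ⟨h1, h2⟩ := ih
    generalize (Um B * Tm p) ^ (2 ^ i) = g at *
    have hdet : g 0 0 * g 1 1 - g 0 1 * g 1 0 = 1 := by
      rw [← Matrix.det_fin_two]; exact g.2
    rw [Finset.prod_range_succ, ← h2, tr, ← h1]
    simp only [Matrix.SpecialLinearGroup.coe_mul, Matrix.mul_apply, Fin.sum_univ_two]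
    constructor
    · linear_combination (-2 : B) * hdet
    · ring

theorem tr_form (i : ℕ) : ∃ z : B, tr p i = p ^ (2 ^ i) + 2 * z := by
  induction i with
  | zero => exact ⟨-1, by simp [tr]; ring⟩
  | succ i ih =>
    obtain ⟨z, hz⟩ := ih
    refine ⟨2 * z ^ 2 + 2 * z * p ^ (2 ^ i) - 1, ?_⟩
    rw [tr, hz, pow_succ 2, pow_mul]; ring

theorem tr_unit (h : ChainRing B p e d) (i : ℕ) (hi : 2 ^ i < e) :
    ∃ u : B, IsUnit u ∧ tr p i = p ^ (2 ^ i) * u := by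
  obtain ⟨z, hz⟩ := tr_form (p := p) i
  obtain ⟨u, hu⟩ := h.two
  refine ⟨1 + p * (p ^ (e - 2 ^ i - 1) * u * z), h.isUnit _, ?_⟩
  rw [hz, hu]
  have : p ^ e = p ^ (2 ^ i) * p * p ^ (e - 2 ^ i - 1) := by
    rw [← pow_succ, ← pow_add]; congr 1; omega
  rw [this]; ring

theorem prod_tr (h : ChainRing B p e d) (i : ℕ) (hi : 2 ^ i ≤ e) :
    ∃ u : B, IsUnit u ∧ ∏ l ∈ Finset.range i, tr p l = p ^ (2 ^ i - 1) * u := by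
  induction i with
  | zero => exact ⟨1, isUnit_one, by simp⟩
  | succ i ih =>
    have h2 : 2 ^ i < 2 ^ (i + 1) := Nat.pow_lt_pow_right (by norm_num) (by omega)
    obtain ⟨u, hu, e1⟩ := ih (by omega)
    obtain ⟨v, hv, e2⟩ := h.tr_unit i (by omega)
    refine ⟨u * v, hu.mul hv, ?_⟩
    rw [Finset.prod_range_succ, e1, e2]
    have : 2 ^ (i + 1) - 1 = (2 ^ i - 1) + 2 ^ i := by
      have : 1 ≤ 2 ^ i := Nat.one_le_two_pow
      rw [pow_succ]; omega
    rw [this]; ring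

theorem relIndex_AS (j : ℕ) (h : ChainRing B p (2 ^ j) d) (hj : tr p j = 0) :
    AS p ≤ Subgroup.closure {Tm p, Um B} ∧
    (AS p).relIndex (Subgroup.closure {Tm p, Um B}) = 2 ^ (j + 2) := by
  have := h.fin
  have hd := h.dge
  set G := Subgroup.closure {Tm p, Um B} with hG
  have hT : Tm p ∈ G := Subgroup.subset_closure (by simp)
  have hU : Um B ∈ G := Subgroup.subset_closure (by simp)
  obtain ⟨J, hJ, hJtr, hJ10⟩ := R_pow (B := B) (p := p) j
  obtain ⟨v, hv, hs⟩ := h.prod_tr j le_rfl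
  rw [hs] at hJ10
  rw [hj] at hJtr
  have hR : Um B * Tm p ∈ G := mul_mem hU hT
  have hJG : J ∈ G := by rw [hJ]; exact pow_mem hR _
  have hJI : (J : Matrix (Fin 2) (Fin 2) B) ∈ Iw p := by
    rw [hJ, Matrix.SpecialLinearGroup.coe_pow, Matrix.SpecialLinearGroup.coe_mul]
    exact pow_mem (mul_mem Um_Iw Tm_Iw) _
  have hJdet : J 0 0 * J 1 1 - J 0 1 * J 1 0 = 1 := by
    rw [← Matrix.det_fin_two]; exact J.2
  have hJJ : J * J = -1 := by
    have h11 : J 1 1 = - J 0 0 := by linear_combination hJtr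
    rw [h11] at hJdet
    ext i j
    fin_cases i <;> fin_cases j <;> simp [Matrix.mul_apply, Fin.sum_univ_two, h11]
    · linear_combination -hJdet
    · ring
    · ring
    · linear_combination -hJdet
  have hn : (-1 : SL(2, B)) ∈ G := by rw [← hJJ]; exact mul_mem hJG hJG
  have hW : ∃ W ∈ G, (W : Matrix (Fin 2) (Fin 2) B) ∈ Iw p ∧ ∃ w : B, IsUnit w ∧
      W 0 0 + W 1 1 = 4 * w := by
    refine ⟨J * (Tm p * Tm p), mul_mem hJG (mul_mem hT hT), ?_, ?_⟩
    · simp only [Matrix.SpecialLinearGroup.coe_mul]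
      exact mul_mem hJI (mul_mem Tm_Iw Tm_Iw)
    · obtain ⟨u, hu⟩ := h.two
      refine ⟨↑(u⁻¹) * v, (Units.isUnit _).mul hv, ?_⟩
      have e1 : p ^ (2 ^ j) = 2 * ↑(u⁻¹) := by rw [hu]; simp
      have e2 : p ^ (2 ^ j) = p * p ^ (2 ^ j - 1) := by
        rw [← pow_succ']; congr 1; have := h.epos; omega
      simp [Matrix.SpecialLinearGroup.coe_mul, Matrix.mul_apply, Fin.sum_univ_two, Tm_coe, hJ10]
      rw [e2] at e1
      linear_combination hJtr + 2 * v * e1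
  have hle := AS_le h hn hT hU hW
  refine ⟨hle, ?_⟩
  have hnorm : G ≤ Subgroup.normalizer (AS p) := by
    rw [hG, Subgroup.closure_le]
    rintro x (rfl | rfl)
    · exact Subgroup.mem_normalizer_fintype (fun n hn => AS_T hn)
    · exact Subgroup.mem_normalizer_fintype (fun n hn => AS_U hn)
  have hNormal : ((AS p).subgroupOf G).Normal := by
    exact Subgroup.normal_subgroupOf_of_le_normalizer hnorm
  have hlt : 2 ^ j < d * 2 ^ j := by have := h.epos; nlinarith
  have f1 : ∀ g ∈ AS p, p ^ (2 ^ j) ∣ g 1 0 := by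
    rintro g ⟨b, c, y, z, i, h00, h01, h10, h11⟩
    rw [← one_mul (2 ^ j), ← h.two_pow_dvd, pow_one, h10]
    exact dvd_mul_right _ _
  have fJ : ¬ p ^ (2 ^ j) ∣ J 1 0 := by
    rw [hJ10]
    intro h1
    rw [hv.dvd_mul_right] at h1
    have := h.epos
    exact h.not_dvd _ _ (by omega) (by omega) h1
  unfold Subgroup.relIndex Subgroup.index
  let q := QuotientGroup.mk' ((AS p).subgroupOf G)
  have hq : ∀ x (hx : x ∈ G), q ⟨x, hx⟩ = 1 ↔ x ∈ AS p := by
    intro x hx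
    simp only [q, QuotientGroup.mk'_apply, QuotientGroup.eq_one_iff, Subgroup.mem_subgroupOf]
  have hqJ : (q ⟨Um B, hU⟩ * q ⟨Tm p, hT⟩) ^ 2 ^ j = q ⟨J, hJG⟩ := by
    rw [← map_mul, ← map_pow]
    congr 1
    apply Subtype.ext
    simp [hJ]
  have hneg : (-1 : SL(2, B)) ∈ AS p :=
    ⟨0, 0, 0, 0, -1, by simp; ring, by simp, by simp, by simp; ring⟩
  apply dihedral_card (q ⟨Tm p, hT⟩) (q ⟨Um B, hU⟩) j
  · rw [← map_mul]
    refine (hq _ (mul_mem hT hT)).mpr ⟨1, 0, 0, 0, -1, ?_, ?_, ?_, ?_⟩ <;>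
    simp [Tm_coe]; ring
  · rw [← map_mul]
    refine (hq _ (mul_mem hU hU)).mpr ⟨0, -1, 0, 0, 1, ?_, ?_, ?_, ?_⟩ <;>
    simp [Um_coe]; ring
  · rw [eq_top_iff]
    rintro x -
    obtain ⟨⟨g, hg⟩, rfl⟩ := QuotientGroup.mk'_surjective _ x
    change q ⟨g, hg⟩ ∈ _
    induction hg using Subgroup.closure_induction with
    | mem x hx =>
      apply Subgroup.subset_closure
      rcases hx with rfl | rfl <;> simp
    | one => exact one_mem _
    | mul x y hx hy h1 h2 => exact mul_mem h1 h2
    | inv x hx h1 => exact inv_mem h1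
  · rw [pow_succ, pow_mul, hqJ, pow_two, ← map_mul]
    refine (hq _ (mul_mem hJG hJG)).mpr ?_
    rw [hJJ]; exact hneg
  · rw [hqJ, Ne, hq]
    exact fun h1 => fJ (f1 _ h1)
  · rw [Ne, hq]
    rintro ⟨b, c, y, z, i, h00, h01, h10, h11⟩
    simp [Tm_coe] at h01
    have h2 : p * 2 ∣ p := ⟨b, by linear_combination h01⟩
    obtain ⟨u, hu⟩ := h.two
    rw [hu, ← mul_assoc, ← pow_succ', Units.mul_right_dvd] at h2
    have := h.epos
    exact h.not_dvd 1 (2 ^ j + 1) (by omega) (by omega) (by rwa [pow_one])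
  · rw [hqJ]
    intro h1
    have h2 : q ⟨J * (Tm p)⁻¹, mul_mem hJG (inv_mem hT)⟩ = 1 := by
      have : q ⟨J * (Tm p)⁻¹, mul_mem hJG (inv_mem hT)⟩ = q ⟨J, hJG⟩ * (q ⟨Tm p, hT⟩)⁻¹ := by
        rw [← map_inv, ← map_mul]; rfl
      rw [this, h1, mul_inv_cancel]
    rw [hq] at h2
    apply fJ
    have := f1 _ h2
    simpa [Tm_coe, Matrix.adjugate_fin_two, Matrix.mul_apply, Fin.sum_univ_two] using this

end ChainRing


namespace ChainRing

variable {B : Type*} [CommRing B] {p : B} {e d : ℕ} {G : Subgroup SL(2, B)}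

theorem N_pos (h : ChainRing B p e d) : 3 * e ≤ d * e := by
  have := h.epos; have := h.dge; nlinarith

theorem unit_iff (h : ChainRing B p e d) (x : B) : ¬ p ∣ x ↔ IsUnit x := by
  constructor
  · intro hx
    obtain ⟨y, rfl | rfl⟩ := h.res x
    · exact absurd (dvd_mul_right _ _) hx
    · exact h.isUnit y
  · intro hx hp
    have h1 : p ^ 1 ∣ p ^ 0 := by
      rw [pow_one, pow_zero]
      exact hp.trans (isUnit_iff_dvd_one.mp hx)
    have := h.N_pos
    have := h.epos
    exact h.not_dvd 0 1 (by omega) (by omega) h1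

theorem card_nonunit (h : ChainRing B p e d) : Nat.card {x : B // p ∣ x} = 2 ^ (d * e - 1) := by
  have := h.N_pos
  have := h.epos
  have := h.card_dvd 1 (by omega)
  rwa [pow_one] at this

theorem card_unit (h : ChainRing B p e d) : Nat.card {x : B // ¬ p ∣ x} = 2 ^ (d * e - 1) := by
  have := h.fin
  classical
  have h0 := h.N_pos
  have h00 := h.epos
  have h1 := h.card_nonunit
  have h2 := Nat.card_congr (Equiv.sumCompl (fun x : B => p ∣ x))
  rw [Nat.card_sum, h1, h.card] at h2
  have : 2 ^ (d * e) = 2 ^ (d * e - 1) * 2 := by rw [← pow_succ]; congr 1; omega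
  omega

theorem sl_ext0 {g g' : SL(2, B)} (hu : IsUnit (g 0 0)) (h00 : g 0 0 = g' 0 0)
    (h01 : g 0 1 = g' 0 1) (h10 : g 1 0 = g' 1 0) : g = g' := by
  have hd : g 0 0 * g 1 1 - g 0 1 * g 1 0 = 1 := by
    rw [← Matrix.det_fin_two]; exact g.2
  have hd' : g' 0 0 * g' 1 1 - g' 0 1 * g' 1 0 = 1 := by
    rw [← Matrix.det_fin_two]; exact g'.2
  have h11 : g 1 1 = g' 1 1 := by
    apply hu.mul_left_cancel
    rw [← h00, ← h01, ← h10] at hd'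
    linear_combination hd - hd'
  ext i j
  fin_cases i <;> fin_cases j <;> assumption

theorem sl_ext1 {g g' : SL(2, B)} (hu : IsUnit (g 0 1)) (h00 : g 0 0 = g' 0 0)
    (h01 : g 0 1 = g' 0 1) (h11 : g 1 1 = g' 1 1) : g = g' := by
  have hd : g 0 0 * g 1 1 - g 0 1 * g 1 0 = 1 := by
    rw [← Matrix.det_fin_two]; exact g.2
  have hd' : g' 0 0 * g' 1 1 - g' 0 1 * g' 1 0 = 1 := by
    rw [← Matrix.det_fin_two]; exact g'.2
  have h10 : g 1 0 = g' 1 0 := by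
    apply hu.mul_left_cancel
    rw [← h00, ← h01, ← h11] at hd'
    linear_combination hd' - hd
  ext i j
  fin_cases i <;> fin_cases j <;> assumption

theorem card_SL (h : ChainRing B p e d) : Nat.card SL(2, B) = 3 * 2 ^ (3 * (d * e) - 2) := by
  have := h.fin
  classical
  have hN := h.N_pos
  have he := h.epos
  have h1 : Nat.card {g : SL(2, B) // ¬ p ∣ g 0 0} = 2 ^ (d * e - 1) * (2 ^ (d * e) * 2 ^ (d * e))
      := by
    rw [← h.card_unit, ← h.card, ← Nat.card_prod, ← Nat.card_prod]
    refine Nat.card_congr (Equiv.ofBijective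
      (fun g => (⟨g.1 0 0, g.2⟩, g.1 0 1, g.1 1 0)) ⟨?_, ?_⟩)
    · rintro ⟨g, hg⟩ ⟨g', hg'⟩ heq
      simp only [Prod.mk.injEq, Subtype.mk.injEq] at heq ⊢
      exact sl_ext0 ((h.unit_iff _).mp hg) heq.1 heq.2.1 heq.2.2
    · rintro ⟨⟨a, ha⟩, b, c⟩
      obtain ⟨i, hi⟩ := isUnit_iff_exists_inv.mp ((h.unit_iff _).mp ha)
      refine ⟨⟨⟨!![a, b; c, i * (1 + b * c)], ?_⟩, by simpa using ha⟩, ?_⟩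
      · rw [Matrix.det_fin_two_of]; linear_combination (1 + b * c) * hi
      · simp
  have h2 : Nat.card {g : SL(2, B) // p ∣ g 0 0} = 2 ^ (d * e - 1) * (2 ^ (d * e - 1) * 2 ^ (d * e))
      := by
    have hb : ∀ g : SL(2, B), p ∣ g 0 0 → ¬ p ∣ g 0 1 := by
      intro g h0 h1
      have hd : g 0 0 * g 1 1 - g 0 1 * g 1 0 = 1 := by
        rw [← Matrix.det_fin_two]; exact g.2
      have : p ∣ 1 := by
        rw [← hd]; exact dvd_sub (h0.mul_right _) (h1.mul_right _)
      exact (h.unit_iff 1).mpr isUnit_one this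
    nth_rewrite 2 [← h.card_unit]
    rw [← h.card_nonunit, ← h.card, ← Nat.card_prod, ← Nat.card_prod]
    refine Nat.card_congr (Equiv.ofBijective
      (fun g => (⟨g.1 0 0, g.2⟩, ⟨g.1 0 1, hb _ g.2⟩, g.1 1 1)) ⟨?_, ?_⟩)
    · rintro ⟨g, hg⟩ ⟨g', hg'⟩ heq
      simp only [Prod.mk.injEq, Subtype.mk.injEq] at heq ⊢
      exact sl_ext1 ((h.unit_iff _).mp (hb _ hg)) heq.1 heq.2.1 heq.2.2
    · rintro ⟨⟨a, ha⟩, ⟨b, hb⟩, c⟩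
      obtain ⟨i, hi⟩ := isUnit_iff_exists_inv.mp ((h.unit_iff _).mp hb)
      refine ⟨⟨⟨!![a, b; i * (a * c - 1), c], ?_⟩, by simpa using ha⟩, ?_⟩
      · rw [Matrix.det_fin_two_of]; linear_combination (1 - a * c) * hi
      · simp
  have h3 := Nat.card_congr (Equiv.sumCompl (fun g : SL(2, B) => p ∣ g 0 0))
  rw [Nat.card_sum, h1, h2] at h3
  rw [← h3]
  obtain ⟨m, hm⟩ : ∃ m, d * e = m + 1 := ⟨d * e - 1, by omega⟩
  rw [hm, show 3 * (m + 1) - 2 = m + m + (m + 1) by omega, Nat.add_sub_cancel]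
  ring

theorem card_AS (h : ChainRing B p e d) : Nat.card (AS p) = 2 ^ (3 * (d * e) - 4 * e) := by
  have := h.fin
  have hN := h.N_pos
  have he := h.epos
  obtain ⟨u, hu⟩ := h.two
  have hσ : ∀ x : {x : B // p ^ (e + 1) ∣ x}, ∃ b, x.1 = 2 * p * b := by
    rintro ⟨x, z, rfl⟩
    exact ⟨↑u⁻¹ * z, by rw [hu]; simp only [pow_succ]; linear_combination (-(p ^ e * p * z)) * u.mul_inv⟩
  have hτ : ∀ x : {x : B // p ^ (1 * e) ∣ x}, ∃ b, x.1 = 2 * b := by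
    rintro ⟨x, hx⟩
    rw [← h.two_pow_dvd, pow_one] at hx
    exact hx
  choose σ hσ using hσ
  choose τ hτ using hτ
  have hF : ∀ q : ({x : B // p ^ (e + 1) ∣ x} × {x : B // p ^ (1 * e) ∣ x}) ×
      ({x : B // p ^ (2 * e) ∣ x} × Bool), ∃ g : AS p, g.1 0 0 = 1 + 2 * (σ q.1.1 + τ q.1.2 +
        (if q.2.2 then (1 : ℤ) else 0 : ℤ)) + q.2.1.1 ∧ g.1 0 1 = q.1.1.1 ∧ g.1 1 0 = q.1.2.1 := by
    rintro ⟨⟨b', c'⟩, ⟨y', hy'⟩, ε⟩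
    simp only
    rw [← h.two_pow_dvd] at hy'
    obtain ⟨y, rfl⟩ := hy'
    generalize hi : (if ε then (1 : ℤ) else 0 : ℤ) = i
    have hb := hσ b'
    have hc := hτ c'
    generalize σ b' = b at *
    generalize τ c' = c at *
    rw [hb, hc]
    have hunit : IsUnit (1 + 2 * (b + c + i) + 2 ^ 2 * y : B) := by
      obtain ⟨t, ht⟩ := h.p_dvd_two
      rw [show (1 + 2 * (b + c + i) + 2 ^ 2 * y : B) = 1 + p * (t * (b + c + i + 2 * y)) by
        linear_combination (b + c + i + 2 * y) * ht]
      exact h.isUnit _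
    obtain ⟨w, hw⟩ := isUnit_iff_exists_inv.mp hunit
    refine ⟨⟨⟨!![1 + 2 * (b + c + i) + 2 ^ 2 * y, 2 * p * b; 2 * c, w * (1 + 2 * p * b * (2 * c))],
      ?_⟩, ?_⟩, ?_⟩
    · rw [Matrix.det_fin_two_of]; linear_combination (1 + 2 * p * b * (2 * c)) * hw
    · refine ⟨b, c, y, w * (p * b * c - (b + c + i) - (b + c + i) ^ 2 - y * (1 + 2 * (b + c + i))),
        i, ?_, ?_, ?_, ?_⟩ <;> simp
      · ring
      · linear_combination (1 + 2 * (b + c + i)) * hw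
    · simp
  choose F hF0 hF1 hF2 using hF
  have h42 : ¬ p ^ (2 * e) ∣ (2 : B) := by
    rw [hu, Units.dvd_mul_right]
    exact h.not_dvd _ _ (by omega) (by omega)
  have hbij : Function.Bijective F := by
    constructor
    · rintro ⟨⟨b, c⟩, ⟨y, hy⟩, ε⟩ ⟨⟨b', c'⟩, ⟨y', hy'⟩, ε'⟩ heq
      have e1 := hF1 ((b, c), (⟨y, hy⟩, ε))
      have e2 := hF2 ((b, c), (⟨y, hy⟩, ε))
      have e0 := hF0 ((b, c), (⟨y, hy⟩, ε))
      rw [heq, hF1] at e1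
      rw [heq, hF2] at e2
      rw [heq, hF0] at e0
      simp only at e0 e1 e2
      have e1 := Subtype.ext e1
      have e2 := Subtype.ext e2
      subst e1 e2
      cases ε <;> cases ε' <;> simp at e0
      · simp [e0]
      · exfalso; apply h42
        rw [show (2 : B) = y - y' by linear_combination e0]
        exact dvd_sub hy hy'
      · exfalso; apply h42
        rw [show (2 : B) = y' - y by linear_combination -e0]
        exact dvd_sub hy' hy
      · simp [e0]
    · rintro ⟨g, b, c, y, z, i, h00, h01, h10, h11⟩
      have hb : p ^ (e + 1) ∣ g 0 1 := by
        rw [h01, hu, pow_succ]; exact ⟨u * b, by ring⟩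
      have hc : p ^ (1 * e) ∣ g 1 0 := by
        rw [← h.two_pow_dvd, h10, pow_one]; exact dvd_mul_right _ _
      have k1 := hσ ⟨_, hb⟩
      have k2 := hτ ⟨_, hc⟩
      set b2 := σ ⟨_, hb⟩ with hb2
      set c2 := τ ⟨_, hc⟩ with hc2
      simp only at k1 k2
      have m1 : (2 : B) ∣ b - b2 := by
        have : (2 : B) ^ 1 * p ^ 1 * (b - b2) = 0 := by
          rw [pow_one, pow_one, mul_sub, ← k1, ← h01, sub_self]
        rw [h.two_pow_mul] at this
        have := h.dvd_of_mul _ (1 * e) (by omega) _ this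
        rwa [← h.two_pow_dvd, pow_one] at this
      have m2 : (2 : B) ∣ c - c2 := by
        have : (2 : B) ^ 1 * p ^ 0 * (c - c2) = 0 := by
          rw [pow_one, pow_zero, mul_one, mul_sub, ← k2, ← h10, sub_self]
        rw [h.two_pow_mul] at this
        have := h.dvd_of_mul _ (1 * e) (by omega) _ this
        rwa [← h.two_pow_dvd, pow_one] at this
      obtain ⟨x1, hx1⟩ := m1
      obtain ⟨x2, hx2⟩ := m2
      obtain ⟨m, ε, hi⟩ : ∃ m : ℤ, ∃ ε : Bool, i = 2 * m + (if ε then (1 : ℤ) else 0 : ℤ) := by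
        obtain ⟨m, rfl | rfl⟩ := Int.even_or_odd' i
        · exact ⟨m, false, by simp⟩
        · exact ⟨m, true, by simp⟩
      have hy : p ^ (2 * e) ∣ (2 ^ 2 * (x1 + x2 + m + y) : B) := by
        rw [← h.two_pow_dvd]; exact dvd_mul_right _ _
      refine ⟨((⟨_, hb⟩, ⟨_, hc⟩), (⟨_, hy⟩, ε)), ?_⟩
      apply Subtype.ext
      symm
      apply sl_ext0
      · rw [h00]
        obtain ⟨t, ht⟩ := h.p_dvd_two
        rw [show (1 + 2 * (b + c + i) + 4 * y : B) = 1 + p * (t * (b + c + i + 2 * y)) by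
          linear_combination (b + c + i + 2 * y) * ht]
        exact h.isUnit _
      · rw [hF0, h00, ← hb2, ← hc2]
        have : (i : B) = 2 * m + ((if ε then (1 : ℤ) else 0 : ℤ) : B) := by
          rw [hi]; push_cast; rfl
        rw [this]
        linear_combination 2 * hx1 + 2 * hx2
      · rw [hF1]
      · rw [hF2]
  rw [← Nat.card_congr (Equiv.ofBijective F hbij), Nat.card_prod, Nat.card_prod, Nat.card_prod,
    h.card_dvd _ (by omega), h.card_dvd _ (by omega), h.card_dvd _ (by omega)]
  simp only [Nat.card_eq_fintype_card, Fintype.card_bool]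
  rw [← pow_succ, ← pow_add, ← pow_add]
  congr 1
  omega

theorem index_main (j : ℕ) (h : ChainRing B p (2 ^ j) d) (hj : tr p j = 0) :
    (Subgroup.closure {Tm p, Um B}).index = 3 * 2 ^ (2 ^ (j + 2) - (j + 2) - 2) := by
  have := h.fin
  have hN := h.N_pos
  have he := h.epos
  obtain ⟨hle, hrel⟩ := relIndex_AS j h hj
  have h1 := Subgroup.relIndex_mul_index hle
  have h2 := Subgroup.card_mul_index (AS p)
  rw [← h1, hrel, h.card_AS, h.card_SL] at h2
  have hpow : 2 ^ (j + 2) = 4 * 2 ^ j := by ring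
  have hj2 : j + 1 ≤ 2 ^ j := Nat.lt_two_pow_self
  have h3 : 3 * 2 ^ (3 * (d * 2 ^ j) - 2) = 2 ^ (3 * (d * 2 ^ j) - 4 * 2 ^ j) * (2 ^ (j + 2) *
      (3 * 2 ^ (2 ^ (j + 2) - (j + 2) - 2))) := by
    have : 3 * (d * 2 ^ j) - 2 = (3 * (d * 2 ^ j) - 4 * 2 ^ j) + (j + 2) +
      (2 ^ (j + 2) - (j + 2) - 2) := by rw [hpow]; omega
    rw [this, pow_add, pow_add]; ring
  rw [h3] at h2
  have h4 := Nat.eq_of_mul_eq_mul_left (by positivity) h2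
  exact Nat.eq_of_mul_eq_mul_left (by positivity) h4

end ChainRing


namespace ChainRing

theorem tr_map {A B : Type*} [CommRing A] [CommRing B] (f : A →+* B) (p : A) (i : ℕ) :
    f (tr p i) = tr (f p) i := by
  induction i with
  | zero => simp [tr, map_ofNat f 2]
  | succ i ih => simp [tr, ih, map_ofNat f 2]

theorem tr_form' {A : Type*} [CommRing A] (p : A) (i : ℕ) :
    ∃ z, tr p i = p ^ (2 ^ i) + 2 * (-1 + 2 * z) := by
  induction i with
  | zero => exact ⟨0, by simp [tr]; ring⟩
  | succ i ih =>
    obtain ⟨z, hz⟩ := ih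
    refine ⟨p ^ (2 ^ i) * (-1 + 2 * z) + (-1 + 2 * z) ^ 2 - p ^ (2 ^ i) * (-1 + 2 * z) * 0
      + 0 * z, ?_⟩
    have e : p ^ (2 ^ (i + 1)) = (p ^ (2 ^ i)) ^ 2 := by rw [← pow_mul, pow_succ]
    simp only [tr, hz, e]
    ring

theorem tr_zeta (ζ : ℂ) (h0 : ζ ≠ 0) (i : ℕ) :
    tr (2 + (ζ + ζ⁻¹)) i = ζ ^ (2 ^ i) + (ζ ^ (2 ^ i))⁻¹ := by
  induction i with
  | zero => simp [tr]
  | succ i ih =>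
    have h1 : ζ ^ (2 ^ i) ≠ 0 := pow_ne_zero _ h0
    have e : ζ ^ (2 ^ (i + 1)) = (ζ ^ (2 ^ i)) ^ 2 := by rw [← pow_mul, pow_succ]
    simp only [tr, ih, e]
    field_simp
    ring

theorem tr_zeta_zero (ζ : ℂ) (j : ℕ) (hζ : IsPrimitiveRoot ζ (2 ^ (j + 2))) :
    tr (2 + (ζ + ζ⁻¹)) j = 0 := by
  have h0 : ζ ≠ 0 := hζ.ne_zero (by positivity)
  rw [tr_zeta ζ h0]
  have hw : IsPrimitiveRoot (ζ ^ (2 ^ j)) 4 :=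
    hζ.pow (by positivity) (by rw [pow_add]; norm_num)
  have h2 : IsPrimitiveRoot ((ζ ^ (2 ^ j)) ^ 2) 2 := hw.pow (by norm_num) (by norm_num)
  have h3 : (ζ ^ (2 ^ j)) ^ 2 = -1 := h2.eq_neg_one_of_two_right
  have h1 : ζ ^ (2 ^ j) ≠ 0 := pow_ne_zero _ h0
  field_simp
  rw [h3]; ring

theorem tr_lam (ζ : ℂ) (j : ℕ) (hζ : IsPrimitiveRoot ζ (2 ^ (j + 2))) :
    tr (2 + lamO ζ) j = 0 := by
  apply Subtype.val_injective
  have := tr_map (Oring ζ).val.toRingHom (2 + lamO ζ) j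
  have h2 := tr_zeta_zero ζ j hζ
  have e : (Oring ζ).val.toRingHom (2 + lamO ζ) = 2 + (ζ + ζ⁻¹) := by
    simp [lamO]
    rfl
  rw [e, h2] at this
  exact this

open Polynomial in
theorem tr_X (j : ℕ) : (tr (X : ℤ[X]) j).Monic ∧ (tr (X : ℤ[X]) j).natDegree = 2 ^ j := by
  induction j with
  | zero =>
    have : tr (X : ℤ[X]) 0 = X - C 2 := by simp [tr]
    rw [this]
    exact ⟨monic_X_sub_C 2, natDegree_X_sub_C 2⟩
  | succ j ih =>
    obtain ⟨h1, h2⟩ := ih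
    have e : tr (X : ℤ[X]) (j + 1) = tr X j ^ 2 - C 2 := by simp [tr]
    have hd : (tr (X : ℤ[X]) j ^ 2).natDegree = 2 ^ (j + 1) := by
      rw [h1.natDegree_pow, h2, pow_succ]; ring
    have hp : 0 < (tr (X : ℤ[X]) j ^ 2).natDegree := by rw [hd]; positivity
    rw [e]
    refine ⟨(h1.pow 2).sub_of_left ?_, ?_⟩
    · exact lt_of_le_of_lt degree_C_le (natDegree_pos_iff_degree_pos.1 hp)
    · rw [natDegree_sub_C, hd]

open Polynomial in
theorem tr_irr (j : ℕ) : Irreducible (tr (X : ℤ[X]) j) := by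
  obtain ⟨hm, hd⟩ := tr_X j
  obtain ⟨z, hz⟩ := tr_form' (X : ℤ[X]) j
  have hc : ∀ n, (tr (X : ℤ[X]) j).coeff n =
      (if n = 2 ^ j then 1 else 0) + 2 * ((if n = 0 then -1 else 0) + 2 * z.coeff n) := by
    intro n
    have e : tr (X : ℤ[X]) j = X ^ (2 ^ j) + C 2 * (-C 1 + C 2 * z) := by
      rw [hz]; simp
    rw [e]
    simp only [coeff_add, coeff_X_pow, coeff_C_mul, coeff_neg, coeff_C]
    split_ifs <;> simp
  have hpr : (Ideal.span {(2 : ℤ)}).IsPrime :=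
    (Ideal.span_singleton_prime (by norm_num)).2 Int.prime_two
  have hE : (tr (X : ℤ[X]) j).IsEisensteinAt (Ideal.span {(2 : ℤ)}) := by
    refine ⟨hm.leadingCoeff_notMem hpr.ne_top, ?_, ?_⟩
    · intro n hn
      rw [hd] at hn
      rw [Ideal.mem_span_singleton, hc, if_neg hn.ne, zero_add]
      exact dvd_mul_right _ _
    · rw [Ideal.span_singleton_pow, Ideal.mem_span_singleton, hc, if_neg (by positivity), if_pos rfl]
      omega
  exact hE.irreducible hpr hm.isPrimitive (by rw [hd]; positivity)

open Polynomial in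
theorem finrank_O (ζ : ℂ) (j : ℕ) (hζ : IsPrimitiveRoot ζ (2 ^ (j + 2))) :
    Module.Free ℤ (Oring ζ) ∧ Module.Finite ℤ (Oring ζ) ∧
      Module.finrank ℤ (Oring ζ) = 2 ^ j := by
  have hE : Oring ζ = Algebra.adjoin ℤ {2 + (ζ + ζ⁻¹)} := by
    apply le_antisymm
    · apply Algebra.adjoin_le
      rw [Set.singleton_subset_iff]
      have h1 : 2 + (ζ + ζ⁻¹) ∈ Algebra.adjoin ℤ {2 + (ζ + ζ⁻¹)} :=
        Algebra.subset_adjoin rfl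
      have := sub_mem h1 (ofNat_mem (Algebra.adjoin ℤ {2 + (ζ + ζ⁻¹)}) 2)
      simpa using this
    · apply Algebra.adjoin_le
      rw [Set.singleton_subset_iff]
      have h1 : ζ + ζ⁻¹ ∈ Oring ζ := Algebra.subset_adjoin rfl
      exact add_mem (ofNat_mem (Oring ζ) 2) h1
  have hr : aeval (2 + (ζ + ζ⁻¹)) (tr (X : ℤ[X]) j) = 0 := by
    have := tr_map (aeval (R := ℤ) (2 + (ζ + ζ⁻¹))).toRingHom (X : ℤ[X]) j
    have e : (aeval (R := ℤ) (2 + (ζ + ζ⁻¹))).toRingHom (X : ℤ[X]) = 2 + (ζ + ζ⁻¹) := by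
      simp
    rw [e, tr_zeta_zero ζ j hζ] at this
    exact this
  obtain ⟨hm, hd⟩ := tr_X j
  have hi : IsIntegral ℤ (2 + (ζ + ζ⁻¹)) := ⟨_, hm, hr⟩
  have hmin : (minpoly ℤ (2 + (ζ + ζ⁻¹))).natDegree = 2 ^ j := by
    obtain ⟨q, hq⟩ := minpoly.isIntegrallyClosed_dvd hi hr
    have hu := (of_irreducible_mul (hq ▸ tr_irr j)).resolve_left (minpoly.not_isUnit _ _)
    have := natDegree_mul (minpoly.ne_zero hi) hu.ne_zero
    rw [← hq, hd, natDegree_eq_zero_of_isUnit hu] at this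
    omega
  rw [hE]
  let pb := Algebra.adjoin.powerBasis' hi
  refine ⟨Module.Free.of_basis pb.basis, pb.finite, ?_⟩
  rw [pb.finrank, ← hmin]
  exact Algebra.adjoin.powerBasis'_dim hi

theorem card_quot (ζ : ℂ) (j d : ℕ) (hζ : IsPrimitiveRoot ζ (2 ^ (j + 2))) :
    Nat.card (Oring ζ ⧸ Ideal.span {(2 : Oring ζ) ^ d}) = 2 ^ (d * 2 ^ j) := by
  obtain ⟨h1, h2, h3⟩ := finrank_O ζ j hζ
  have := AddSubgroup.index_range_nsmul (Oring ζ) (2 ^ d)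
  rw [h3, ← pow_mul] at this
  rw [← this]
  have e : (nsmulAddMonoidHom (α := Oring ζ) (2 ^ d)).range =
      (Ideal.span {(2 : Oring ζ) ^ d}).toAddSubgroup := by
    ext x
    simp only [AddMonoidHom.mem_range, nsmulAddMonoidHom_apply, Submodule.mem_toAddSubgroup,
      Ideal.mem_span_singleton]
    constructor
    · rintro ⟨y, rfl⟩
      exact ⟨y, by simp⟩
    · rintro ⟨y, rfl⟩
      exact ⟨y, by simp⟩
  rw [e]
  rfl

theorem instance_O (ζ : ℂ) (j d : ℕ) (hζ : IsPrimitiveRoot ζ (2 ^ (j + 2))) (hd : 3 ≤ d) :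
    ChainRing (Oring ζ ⧸ Ideal.span {(2 : Oring ζ) ^ d})
      (Ideal.Quotient.mk _ (2 + lamO ζ)) (2 ^ j) d := by
  set J := Ideal.span {(2 : Oring ζ) ^ d} with hJ
  have h2d : (2 : Oring ζ ⧸ J) ^ d = 0 := by
    have : Ideal.Quotient.mk J ((2 : Oring ζ) ^ d) = 0 :=
      Ideal.Quotient.eq_zero_iff_mem.2 (Ideal.mem_span_singleton_self _)
    rwa [map_pow, map_ofNat (Ideal.Quotient.mk J) 2] at this
  have hcard := card_quot ζ j d hζ
  obtain ⟨z, hz⟩ := tr_form' (Ideal.Quotient.mk J (2 + lamO ζ)) j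
  rw [← tr_map, tr_lam ζ j hζ, map_zero] at hz
  generalize hp : Ideal.Quotient.mk J (2 + lamO ζ) = p at *
  have hun : IsUnit (1 - 2 * z) := by
    apply IsNilpotent.isUnit_one_sub
    exact ⟨d, by rw [mul_pow, h2d, zero_mul]⟩
  obtain ⟨u, hu⟩ := hun
  have hpe : p ^ (2 ^ j) = 2 * u := by rw [hu]; linear_combination -hz
  have h2 : (2 : Oring ζ ⧸ J) = p ^ (2 ^ j) * (u⁻¹ : (Oring ζ ⧸ J)ˣ) := by
    rw [hpe, mul_assoc, Units.mul_inv, mul_one]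
  have hp2 : ∃ t, (2 : Oring ζ ⧸ J) = p * t := by
    obtain ⟨m, hm⟩ := Nat.exists_eq_add_of_le' (Nat.one_le_two_pow (n := j))
    refine ⟨p ^ m * (u⁻¹ : (Oring ζ ⧸ J)ˣ), ?_⟩
    rw [hm] at h2
    rw [h2]; ring
  obtain ⟨t, ht⟩ := hp2
  refine ⟨Nat.finite_of_card_ne_zero (by rw [hcard]; positivity), ?_, ⟨u⁻¹, h2⟩, ?_, hcard,
    Nat.one_le_two_pow, hd⟩
  · intro x
    obtain ⟨⟨x, hx⟩, rfl⟩ := Ideal.Quotient.mk_surjective x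
    induction hx using Algebra.adjoin_induction with
    | mem x hx =>
      rw [Set.mem_singleton_iff] at hx
      subst hx
      refine ⟨1 - t, Or.inl ?_⟩
      have : Ideal.Quotient.mk J (2 + lamO ζ) = 2 + Ideal.Quotient.mk J (lamO ζ) := by
        rw [map_add, map_ofNat (Ideal.Quotient.mk J) 2]
      change Ideal.Quotient.mk J (lamO ζ) = _
      rw [hp] at this
      linear_combination -this - ht
    | algebraMap r =>
      have e : Ideal.Quotient.mk J ⟨algebraMap ℤ ℂ r, Subalgebra.algebraMap_mem _ r⟩ =
          ((r : ℤ) : Oring ζ ⧸ J) := by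
        exact map_intCast (Ideal.Quotient.mk J) r
      rcases Int.even_or_odd' r with ⟨m, hm | hm⟩
      · refine ⟨t * m, Or.inl ?_⟩
        refine e.trans ?_
        rw [hm]; push_cast; linear_combination (m : Oring ζ ⧸ J) * ht
      · refine ⟨t * m, Or.inr ?_⟩
        refine e.trans ?_
        rw [hm]; push_cast; linear_combination (m : Oring ζ ⧸ J) * ht
    | add x y hx hy ihx ihy =>
      have e : Ideal.Quotient.mk J ⟨x + y, add_mem hx hy⟩ =
        Ideal.Quotient.mk J ⟨x, hx⟩ + Ideal.Quotient.mk J ⟨y, hy⟩ := rfl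
      rw [e]
      obtain ⟨a, ha | ha⟩ := ihx <;> obtain ⟨b, hb | hb⟩ := ihy <;> rw [ha, hb]
      · exact ⟨a + b, Or.inl (by ring)⟩
      · exact ⟨a + b, Or.inr (by ring)⟩
      · exact ⟨a + b, Or.inr (by ring)⟩
      · exact ⟨a + b + t, Or.inl (by linear_combination ht)⟩
    | mul x y hx hy ihx ihy =>
      have e : Ideal.Quotient.mk J ⟨x * y, mul_mem hx hy⟩ =
        Ideal.Quotient.mk J ⟨x, hx⟩ * Ideal.Quotient.mk J ⟨y, hy⟩ := rfl
      rw [e]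
      obtain ⟨a, ha | ha⟩ := ihx <;> obtain ⟨b, hb | hb⟩ := ihy <;> rw [ha, hb]
      · exact ⟨a * p * b, Or.inl (by ring)⟩
      · exact ⟨a * (1 + p * b), Or.inl (by ring)⟩
      · exact ⟨b * (1 + p * a), Or.inl (by ring)⟩
      · exact ⟨a + b + p * a * b, Or.inr (by ring)⟩
  · rw [mul_comm, pow_mul, hpe, mul_pow, h2d, zero_mul]

end ChainRing

theorem index_two_power_case
    (n k : ℕ) (hk : 2 ≤ k) (hn : n = 2 ^ k)
    (ζ : ℂ) (hζ : IsPrimitiveRoot ζ n)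
    (d : ℕ) (hd : 3 ≤ d) :
    ((Delta ζ).map (SLred ζ (Ideal.span {(2 : Oring ζ) ^ d}))).index =
      3 * 2 ^ (2 ^ k - k - 2) := by
  obtain ⟨j, rfl⟩ := Nat.exists_eq_add_of_le' hk
  subst hn
  have hmain := ChainRing.index_main j (ChainRing.instance_O ζ j d hζ hd)
    (by rw [← ChainRing.tr_map, ChainRing.tr_lam ζ j hζ, map_zero])
  rw [← hmain]
  congr 1
  rw [Delta, MonoidHom.map_closure, Set.image_pair]
  have hT : SLred ζ (Ideal.span {(2 : Oring ζ) ^ d}) (Tmat ζ) =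
      ChainRing.Tm (Ideal.Quotient.mk (Ideal.span {(2 : Oring ζ) ^ d}) (2 + lamO ζ)) := by
    apply Subtype.ext
    change (Tmat ζ).1.map (Ideal.Quotient.mk _) = _
    rw [Tmat, ChainRing.Tm_coe]
    ext i l
    fin_cases i <;> fin_cases l <;> simp
  have hU : SLred ζ (Ideal.span {(2 : Oring ζ) ^ d}) (Umat ζ) =
      ChainRing.Um (Oring ζ ⧸ Ideal.span {(2 : Oring ζ) ^ d}) := by
    apply Subtype.ext
    change (Umat ζ).1.map (Ideal.Quotient.mk _) = _
    rw [Umat, ChainRing.Um_coe]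
    ext i l
    fin_cases i <;> fin_cases l <;> simp
  rw [hT, hU]

end
end
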